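/- arXiv:math/0411293 — 6 statements merged into one kernel-verified Lean document; each statement's English description precedes it below -/
import Mathlib

section
/- Let α₁, α₂ ∈ ℝ be such that 1, α₁, α₂ are linearly independent over ℚ. Then there exist infinitely many indices ν such that the determinant Δ²_ν of the 3×3 matrix whose rows are the three consecutive best approximations m_ν, m_{ν+1}, m_{ν+2} (in the sense of linear form) is nonzero. -/
open scoped BigOperators

/-- `ζ(m) = |m₀ + m₁α₁ + … + m_rα_r|` : value of the linear form at the integer point `m`. -/
noncomputable def zetaLF {r : ℕ} (α : Fin r → ℝ) (m : Fin (r + 1) → ℤ) : ℝ :=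
  |(m 0 : ℝ) + ∑ j : Fin r, (m j.succ : ℝ) * α j|

/-- `M(m) = max_j |m_j|`. -/
def heightLF {r : ℕ} (m : Fin (r + 1) → ℤ) : ℕ :=
  Finset.univ.sup fun j => (m j).natAbs

/-- `m ≠ 0` is a best approximation in the sense of linear form:
`ζ(m) = min {ζ(n) : n ≠ 0, M(n) ≤ M(m)}`. -/
def IsBestApproxLF {r : ℕ} (α : Fin r → ℝ) (m : Fin (r + 1) → ℤ) : Prop :=
  m ≠ 0 ∧ ∀ n : Fin (r + 1) → ℤ, n ≠ 0 → heightLF n ≤ heightLF m →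
    zetaLF α m ≤ zetaLF α n

/-- `m : ℕ → ℤ^{r+1}` enumerates the best approximations to the linear form given by `α`,
ordered by strictly increasing height, and exhaustively (every best approximation occurs
at one of the heights `M_ν`). -/
def IsBestApproxSeqLF {r : ℕ} (α : Fin r → ℝ) (m : ℕ → Fin (r + 1) → ℤ) : Prop :=
  (∀ ν : ℕ, IsBestApproxLF α (m ν)) ∧
  (∀ ν : ℕ, heightLF (m ν) < heightLF (m (ν + 1))) ∧
  (∀ n : Fin (r + 1) → ℤ, IsBestApproxLF α n → ∃ ν : ℕ, heightLF (m ν) = heightLF n)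

/-- `1, α₁, …, α_r` are linearly independent over `ℚ`. -/
def QIndepLF {r : ℕ} (α : Fin r → ℝ) : Prop :=
  ∀ c : Fin (r + 1) → ℤ, ((c 0 : ℝ) + ∑ j : Fin r, (c j.succ : ℝ) * α j = 0) → c = 0

open scoped Matrix

theorem heightLF_le_iff {r : ℕ} (m : Fin (r + 1) → ℤ) (H : ℕ) :
    heightLF m ≤ H ↔ ∀ j, (m j).natAbs ≤ H := by
  simp [heightLF, Finset.sup_le_iff]

theorem abs_le_heightLF {r : ℕ} (m : Fin (r + 1) → ℤ) (j : Fin (r + 1)) :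
    |(m j : ℝ)| ≤ heightLF m := by
  have h : (m j).natAbs ≤ heightLF m := (heightLF_le_iff m _).1 le_rfl j
  rw [← Int.cast_abs, Int.abs_eq_natAbs]
  exact_mod_cast h

theorem exists_abs_eq_heightLF {r : ℕ} (m : Fin (r + 1) → ℤ) :
    ∃ j, |(m j : ℝ)| = heightLF m := by
  obtain ⟨j, -, hj⟩ := Finset.exists_mem_eq_sup Finset.univ Finset.univ_nonempty
    (fun j => (m j).natAbs)
  refine ⟨j, ?_⟩
  rw [← Int.cast_abs, Int.abs_eq_natAbs, heightLF, hj]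
  simp

theorem finite_setOf_heightLF_le {r : ℕ} (H : ℕ) :
    {m : Fin (r + 1) → ℤ | heightLF m ≤ H}.Finite := by
  refine (Set.finite_Icc (fun _ => -(H : ℤ)) (fun _ => (H : ℤ))).subset fun m hm => ?_
  have h := (heightLF_le_iff m H).1 hm
  constructor <;> intro j <;> have := h j <;> dsimp only <;> omega

/-- Below the height of any nonzero integer point there is a best approximation at which the
linear form is at most as large. -/
theorem exists_isBestApproxLF_le {r : ℕ} (α : Fin r → ℝ) {n : Fin (r + 1) → ℤ} (hn : n ≠ 0) :
    ∃ p, IsBestApproxLF α p ∧ heightLF p ≤ heightLF n ∧ zetaLF α p ≤ zetaLF α n := by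
  have hfin : {p : Fin (r + 1) → ℤ | p ≠ 0 ∧ heightLF p ≤ heightLF n}.Finite :=
    (finite_setOf_heightLF_le (heightLF n)).subset fun p hp => hp.2
  obtain ⟨p, hp, hmin⟩ := Set.exists_min_image _ (zetaLF α) hfin ⟨n, hn, le_rfl⟩
  exact ⟨p, ⟨hp.1, fun k hk hkp => hmin k ⟨hk, hkp.trans hp.2⟩⟩, hp.2, hmin n ⟨hn, le_rfl⟩⟩

theorem IsBestApproxSeqLF.strictMono_heightLF {r : ℕ} {α : Fin r → ℝ}
    {m : ℕ → Fin (r + 1) → ℤ} (hm : IsBestApproxSeqLF α m) :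
    StrictMono fun ν => heightLF (m ν) :=
  strictMono_nat_of_lt_succ hm.2.1

theorem IsBestApproxSeqLF.zetaLF_le {r : ℕ} {α : Fin r → ℝ} {m : ℕ → Fin (r + 1) → ℤ}
    (hm : IsBestApproxSeqLF α m) {ν : ℕ} {n : Fin (r + 1) → ℤ} (hn : n ≠ 0)
    (h : heightLF n < heightLF (m (ν + 1))) : zetaLF α (m ν) ≤ zetaLF α n := by
  obtain ⟨p, hp, hpn, hz⟩ := exists_isBestApproxLF_le α hn
  obtain ⟨μ, hμ⟩ := hm.2.2 p hp
  have hlt : heightLF (m μ) < heightLF (m (ν + 1)) := by omega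
  have hμν : μ ≤ ν := Nat.lt_succ_iff.1 (hm.strictMono_heightLF.lt_iff_lt.1 hlt)
  have hle : heightLF (m μ) ≤ heightLF (m ν) := hm.strictMono_heightLF.monotone hμν
  exact ((hm.1 ν).2 p hp.1 (hμ ▸ hle)).trans hz

theorem zetaLF_two (α : Fin 2 → ℝ) (m : Fin 3 → ℤ) :
    zetaLF α m = |(m 0 : ℝ) + m 1 * α 0 + m 2 * α 1| := by
  simp [zetaLF, Fin.sum_univ_two, add_assoc]

/-- Dirichlet's theorem for a linear form in three variables. -/
theorem exists_zetaLF_mul_sq_le (α : Fin 2 → ℝ) :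
    ∃ A : ℕ, 1 ≤ A ∧ ∀ Q : ℕ, 1 ≤ Q →
      ∃ n : Fin 3 → ℤ, n ≠ 0 ∧ heightLF n ≤ A * Q + 1 ∧ zetaLF α n * (Q : ℝ) ^ 2 ≤ 1 := by
  obtain ⟨A, hA⟩ := exists_nat_ge (|α 0| + |α 1| + 1)
  have hA1 : 1 ≤ A := by
    have : (1 : ℝ) ≤ A := by linarith [abs_nonneg (α 0), abs_nonneg (α 1)]
    exact_mod_cast this
  refine ⟨A, hA1, fun Q hQ => ?_⟩
  have hQ0 : (0 : ℝ) < (Q : ℝ) ^ 2 := by positivity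
  let L : ℕ × ℕ → ℝ := fun x => x.1 * α 0 + x.2 * α 1
  obtain ⟨x, hx, y, hy, hxy, hf⟩ := Finset.exists_ne_map_eq_of_card_lt_of_maps_to
    (s := Finset.range (Q + 1) ×ˢ Finset.range (Q + 1)) (t := Finset.range (Q ^ 2))
    (f := fun x => ⌊Int.fract (L x) * (Q : ℝ) ^ 2⌋₊)
    (by simp only [Finset.card_product, Finset.card_range]; nlinarith)
    (by
      intro x _
      simp only [Finset.coe_range, Set.mem_Iio]
      rw [Nat.floor_lt (mul_nonneg (Int.fract_nonneg _) hQ0.le)]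
      push_cast
      nlinarith [Int.fract_lt_one (L x)])
  simp only [Finset.mem_product, Finset.mem_range] at hx hy
  have hclose : |Int.fract (L x) * (Q : ℝ) ^ 2 - Int.fract (L y) * (Q : ℝ) ^ 2| ≤ 1 := by
    have hx0 := mul_nonneg (Int.fract_nonneg (L x)) hQ0.le
    have hy0 := mul_nonneg (Int.fract_nonneg (L y)) hQ0.le
    have h1 := Nat.floor_le hx0
    have h2 := Nat.lt_floor_add_one (Int.fract (L x) * (Q : ℝ) ^ 2)
    have h3 := Nat.floor_le hy0
    have h4 := Nat.lt_floor_add_one (Int.fract (L y) * (Q : ℝ) ^ 2)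
    rw [hf] at h1 h2
    rw [abs_le]
    constructor <;> linarith
  let a : ℤ := x.1 - y.1
  let b : ℤ := x.2 - y.2
  let c : ℤ := ⌊L y⌋ - ⌊L x⌋
  have hfr : Int.fract (L x) - Int.fract (L y) = (c : ℝ) + a * α 0 + b * α 1 := by
    simp only [a, b, c, L, Int.fract]
    push_cast
    ring
  have hz : zetaLF α ![c, a, b] = |Int.fract (L x) - Int.fract (L y)| := by
    rw [hfr, zetaLF_two]
    simp
  have ha : |a| ≤ Q := by rw [abs_le]; constructor <;> dsimp only [a] <;> omega
  have hb : |b| ≤ Q := by rw [abs_le]; constructor <;> dsimp only [b] <;> omega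
  have hc : |c| ≤ A * Q + 1 := by
    have haR : |(a : ℝ)| ≤ Q := by exact_mod_cast ha
    have hbR : |(b : ℝ)| ≤ Q := by exact_mod_cast hb
    have h1 : |(a : ℝ) * α 0| ≤ Q * |α 0| := by
      rw [abs_mul]; exact mul_le_mul_of_nonneg_right haR (abs_nonneg _)
    have h2 : |(b : ℝ) * α 1| ≤ Q * |α 1| := by
      rw [abs_mul]; exact mul_le_mul_of_nonneg_right hbR (abs_nonneg _)
    have h3 : (Q : ℝ) * (|α 0| + |α 1| + 1) ≤ Q * A :=
      mul_le_mul_of_nonneg_left hA (Nat.cast_nonneg _)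
    have hQR : (0 : ℝ) ≤ Q := Nat.cast_nonneg _
    have hcR : |(c : ℝ)| ≤ A * Q + 1 := by
      have := Int.fract_nonneg (L x)
      have := Int.fract_nonneg (L y)
      have := Int.fract_lt_one (L x)
      have := Int.fract_lt_one (L y)
      rw [abs_le] at h1 h2 ⊢
      constructor <;> nlinarith
    exact_mod_cast hcR
  have hAQ : Q ≤ A * Q := Nat.le_mul_of_pos_left Q hA1
  refine ⟨![c, a, b], ?_, ?_, ?_⟩
  · intro h
    have h1 : a = 0 := congrFun h 1
    have h2 : b = 0 := congrFun h 2
    apply hxy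
    ext <;> dsimp only [a, b] at h1 h2 <;> omega
  · rw [heightLF_le_iff, Fin.forall_fin_succ, Fin.forall_fin_two]
    refine ⟨?_, ?_, ?_⟩
    · change c.natAbs ≤ _
      zify
      exact hc
    · change a.natAbs ≤ _
      zify at hAQ ⊢
      linarith
    · change b.natAbs ≤ _
      zify at hAQ ⊢
      linarith
  · rw [hz, ← abs_of_pos hQ0, ← abs_mul, sub_mul]
    exact hclose

theorem QIndepLF.zetaLF_pos {r : ℕ} {α : Fin r → ℝ} (hα : QIndepLF α)
    {m : Fin (r + 1) → ℤ} (hm : m ≠ 0) : 0 < zetaLF α m :=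
  abs_pos.2 fun h => hm (hα m h)

/-- The cross product of `(p × q)` with `(1, α₀, α₁)` is controlled by the values of the
linear form at `p` and `q`. -/
theorem cross_cross_eq (α : Fin 2 → ℝ) (p q : Fin 3 → ℤ) (j : Fin 3) :
    ((fun i => ((p ⨯₃ q) i : ℝ)) ⨯₃ ![1, α 0, α 1]) j =
      q j * (p 0 + p 1 * α 0 + p 2 * α 1) - p j * (q 0 + q 1 * α 0 + q 2 * α 1) := by
  fin_cases j <;> simp [cross_apply] <;> ring

theorem abs_cross_cross_le (α : Fin 2 → ℝ) {p q : Fin 3 → ℤ}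
    (h : heightLF p ≤ heightLF q) (hz : zetaLF α q ≤ zetaLF α p) (j : Fin 3) :
    |((fun i => ((p ⨯₃ q) i : ℝ)) ⨯₃ ![1, α 0, α 1]) j| ≤ 2 * heightLF q * zetaLF α p := by
  rw [cross_cross_eq]
  refine (abs_sub _ _).trans ?_
  rw [abs_mul, abs_mul, ← zetaLF_two, ← zetaLF_two]
  have hpq : (heightLF p : ℝ) ≤ heightLF q := by exact_mod_cast h
  have h1 : |(q j : ℝ)| * zetaLF α p ≤ heightLF q * zetaLF α p :=
    mul_le_mul_of_nonneg_right (abs_le_heightLF q j) (abs_nonneg _)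
  have h2 : |(p j : ℝ)| * zetaLF α q ≤ heightLF q * zetaLF α p :=
    mul_le_mul ((abs_le_heightLF p j).trans hpq) hz (abs_nonneg _) (Nat.cast_nonneg _)
  linarith

theorem cross_ne_zero_of_heightLF_lt {α : Fin 2 → ℝ} (hα : QIndepLF α) {p q : Fin 3 → ℤ}
    (hp : p ≠ 0) (h : heightLF p < heightLF q) (hz : zetaLF α q ≤ zetaLF α p) :
    p ⨯₃ q ≠ 0 := by
  intro h0
  obtain ⟨j, hj⟩ := exists_abs_eq_heightLF q
  have hcc := cross_cross_eq α p q j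
  rw [h0] at hcc
  have hzero : ((fun i => (((0 : Fin 3 → ℤ) i : ℤ) : ℝ)) ⨯₃ ![1, α 0, α 1]) j = 0 := by
    fin_cases j <;> simp [cross_apply]
  rw [hzero] at hcc
  have habs := congrArg abs (sub_eq_zero.1 hcc.symm)
  rw [abs_mul, abs_mul, ← zetaLF_two, ← zetaLF_two, hj] at habs
  have hpos := hα.zetaLF_pos hp
  have hlt : (heightLF p : ℝ) < heightLF q := by exact_mod_cast h
  have h1 : |(p j : ℝ)| * zetaLF α q ≤ heightLF p * zetaLF α p :=
    mul_le_mul (abs_le_heightLF p j) hz (abs_nonneg _) (Nat.cast_nonneg _)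
  nlinarith

theorem QIndepLF.exists_cross_ne_zero {α : Fin 2 → ℝ} (hα : QIndepLF α) {w : Fin 3 → ℤ}
    (hw : w ≠ 0) : ∃ j, ((fun i => (w i : ℝ)) ⨯₃ ![1, α 0, α 1]) j ≠ 0 := by
  by_contra! h
  have h1 := h 1
  have h2 := h 2
  simp [cross_apply] at h1 h2
  have e2 := hα ![w 2, 0, -w 0] (by simp [Fin.sum_univ_two]; linarith)
  have e1 := hα ![w 1, -w 0, 0] (by simp [Fin.sum_univ_two]; linarith)
  apply hw
  ext i
  fin_cases i
  · simpa using congrFun e1 1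
  · simpa using congrFun e1 0
  · simpa using congrFun e2 0

theorem mul_eq_mul_of_dotProduct_eq_zero {w p q : Fin 3 → ℤ} (hp : w ⬝ᵥ p = 0)
    (hq : w ⬝ᵥ q = 0) (i j : Fin 3) : w i * (p ⨯₃ q) j = w j * (p ⨯₃ q) i := by
  simp only [dotProduct, Fin.sum_univ_three] at hp hq
  fin_cases i <;> fin_cases j <;> simp [cross_apply] <;> grind

theorem dotProduct_eq_zero_of_det_eq_zero {w p q s : Fin 3 → ℤ} (hp : w ⬝ᵥ p = 0)
    (hq : w ⬝ᵥ q = 0) (hpq : p ⨯₃ q ≠ 0) (hs : (p ⨯₃ q) ⬝ᵥ s = 0) : w ⬝ᵥ s = 0 := by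
  obtain ⟨i, hi⟩ := Function.ne_iff.1 hpq
  have h : (p ⨯₃ q) i * (w ⬝ᵥ s) = w i * ((p ⨯₃ q) ⬝ᵥ s) := by
    simp only [dotProduct, Finset.mul_sum]
    refine Finset.sum_congr rfl fun j _ => ?_
    linear_combination -s j * mul_eq_mul_of_dotProduct_eq_zero hp hq i j
  rw [hs, mul_zero] at h
  exact (mul_eq_zero.1 h).resolve_left hi

/-- A sequence in `ℤ³` whose consecutive terms are independent and whose consecutive triples
are dependent stays in the plane spanned by its first two terms. -/
theorem dotProduct_cross_eq_zero {m : ℕ → Fin 3 → ℤ} {N : ℕ}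
    (hne : ∀ ν, m ν ⨯₃ m (ν + 1) ≠ 0)
    (hdet : ∀ ν, N ≤ ν → (m ν ⨯₃ m (ν + 1)) ⬝ᵥ m (ν + 2) = 0) {ν : ℕ} (hν : N ≤ ν) :
    (m N ⨯₃ m (N + 1)) ⬝ᵥ m ν = 0 ∧ (m N ⨯₃ m (N + 1)) ⬝ᵥ m (ν + 1) = 0 := by
  induction ν, hν using Nat.le_induction with
  | base =>
    constructor
    · rw [dotProduct_comm, dot_self_cross]
    · rw [dotProduct_comm, dot_cross_self]
  | succ ν hν ih =>
    exact ⟨ih.2, dotProduct_eq_zero_of_det_eq_zero ih.1 ih.2 (hne ν) (hdet ν hν)⟩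

/-- If `1, α₀, α₁` are independent over `ℚ`, then `|(p × q) × (1, α₀, α₁)|` is bounded below
over all independent integer points `p`, `q` of a given rational plane. -/
theorem QIndepLF.exists_pos_le_abs_cross {α : Fin 2 → ℝ} (hα : QIndepLF α) {w : Fin 3 → ℤ}
    (hw : w ≠ 0) : ∃ δ : ℝ, 0 < δ ∧ ∃ j, ∀ p q : Fin 3 → ℤ, w ⬝ᵥ p = 0 → w ⬝ᵥ q = 0 →
      p ⨯₃ q ≠ 0 → δ ≤ |((fun i => ((p ⨯₃ q) i : ℝ)) ⨯₃ ![1, α 0, α 1]) j| := by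
  obtain ⟨j, hj⟩ := hα.exists_cross_ne_zero hw
  obtain ⟨k, hk⟩ := Function.ne_iff.1 hw
  have hk' : 0 < |(w k : ℝ)| := abs_pos.2 (by exact_mod_cast hk)
  refine ⟨|((fun i => (w i : ℝ)) ⨯₃ ![1, α 0, α 1]) j| / |(w k : ℝ)|,
    div_pos (abs_pos.2 hj) hk', j, fun p q hp hq hpq => ?_⟩
  have hpar := mul_eq_mul_of_dotProduct_eq_zero hp hq k
  have huk : (p ⨯₃ q) k ≠ 0 := by
    intro h0
    refine hpq (funext fun i => ?_)
    have hi := hpar i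
    rw [h0, mul_zero] at hi
    exact (mul_eq_zero.1 hi).resolve_left hk
  have h1 : (1 : ℝ) ≤ |((p ⨯₃ q) k : ℝ)| := by exact_mod_cast Int.one_le_abs huk
  have hvec : (w k : ℝ) • (fun i => ((p ⨯₃ q) i : ℝ)) =
      ((p ⨯₃ q) k : ℝ) • fun i => (w i : ℝ) := by
    ext i
    simp only [Pi.smul_apply, smul_eq_mul]
    rw [mul_comm (((p ⨯₃ q) k : ℤ) : ℝ)]
    exact_mod_cast hpar i
  have hcr := congrFun (congrArg (fun v => v ⨯₃ ![1, α 0, α 1]) hvec) j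
  simp only [map_smul, LinearMap.smul_apply, Pi.smul_apply, smul_eq_mul] at hcr
  have habs := congrArg abs hcr
  rw [abs_mul, abs_mul] at habs
  rw [div_le_iff₀ hk', mul_comm, habs]
  exact le_mul_of_one_le_left (abs_nonneg _) h1

/-- The product `M_{ν+1} ζ_ν` takes arbitrarily small values, for all large `ν`. -/
theorem IsBestApproxSeqLF.exists_heightLF_mul_zetaLF_lt {α : Fin 2 → ℝ}
    {m : ℕ → Fin 3 → ℤ} (hm : IsBestApproxSeqLF α m) {δ : ℝ} (hδ : 0 < δ) :
    ∃ N, ∀ ν, N ≤ ν → 2 * (heightLF (m (ν + 1)) : ℝ) * zetaLF α (m ν) < δ := by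
  obtain ⟨A, hA, hD⟩ := exists_zetaLF_mul_sq_le α
  obtain ⟨K, hK⟩ := exists_nat_gt (8 * A / δ)
  refine ⟨A * (K + 1) + 2, fun ν hν => ?_⟩
  set X := heightLF (m (ν + 1)) with hX
  have hνX : ν + 1 ≤ X := hm.strictMono_heightLF.id_le (ν + 1)
  set Q := (X - 2) / A with hQ
  have hKQ : K + 1 ≤ Q := (Nat.le_div_iff_mul_le hA).2 (by rw [mul_comm]; omega)
  have hAQ : A * Q ≤ X - 2 := Nat.mul_div_le _ _
  have hXQ : X - 2 < A * (Q + 1) := Nat.lt_mul_div_succ _ hA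
  obtain ⟨n, hn, hnH, hnz⟩ := hD Q (by omega)
  have hz := hm.zetaLF_le (ν := ν) hn (by omega)
  have hX4 : X ≤ 4 * (A * Q) := by
    have : A ≤ A * Q := Nat.le_mul_of_pos_right A (by omega)
    rw [mul_add] at hXQ
    omega
  have hX4R : (X : ℝ) ≤ 4 * (A * Q) := by exact_mod_cast hX4
  have hQK : (K : ℝ) < Q := by exact_mod_cast (by omega : K < Q)
  have hQ0 : (0 : ℝ) < Q := (Nat.cast_nonneg K).trans_lt hQK
  have hzQ : zetaLF α (m ν) * (Q : ℝ) ^ 2 ≤ 1 :=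
    (mul_le_mul_of_nonneg_right hz (by positivity)).trans hnz
  have hz0 : 0 ≤ zetaLF α (m ν) := abs_nonneg _
  have h8 : 8 * (A : ℝ) < δ * Q := by
    rw [div_lt_iff₀ hδ] at hK
    nlinarith
  have h1 : 2 * (X : ℝ) * zetaLF α (m ν) ≤ 8 * A * Q * zetaLF α (m ν) :=
    mul_le_mul_of_nonneg_right (by linarith) hz0
  have h2 : 8 * A * Q * zetaLF α (m ν) * Q ≤ 8 * A := by
    calc 8 * A * Q * zetaLF α (m ν) * Q = 8 * A * (zetaLF α (m ν) * (Q : ℝ) ^ 2) := by ring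
      _ ≤ 8 * A * 1 := mul_le_mul_of_nonneg_left hzQ (by positivity)
      _ = 8 * A := mul_one _
  exact h1.trans_lt (lt_of_mul_lt_mul_right (h2.trans_lt h8) hQ0.le)

/-- If `1, α₁, α₂` are `ℚ`-linearly independent, then for infinitely
many `ν` the determinant `Δ²_ν` of the matrix with rows `m_ν, m_{ν+1}, m_{ν+2}` is
nonzero. -/
theorem stmt0 (α : Fin 2 → ℝ) (hα : QIndepLF α)
    (m : ℕ → Fin 3 → ℤ) (hm : IsBestApproxSeqLF α m) :
    {ν : ℕ | Matrix.det (Matrix.of fun i j : Fin 3 => m (ν + (i : ℕ)) j) ≠ 0}.Infinite := by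
  intro hfin
  obtain ⟨B, hB⟩ := hfin.bddAbove
  have hz : ∀ ν, zetaLF α (m (ν + 1)) ≤ zetaLF α (m ν) := fun ν =>
    (hm.1 (ν + 1)).2 (m ν) (hm.1 ν).1 (hm.2.1 ν).le
  have hne : ∀ ν, m ν ⨯₃ m (ν + 1) ≠ 0 := fun ν =>
    cross_ne_zero_of_heightLF_lt hα (hm.1 ν).1 (hm.2.1 ν) (hz ν)
  have hdet : ∀ ν, B + 1 ≤ ν → (m ν ⨯₃ m (ν + 1)) ⬝ᵥ m (ν + 2) = 0 := by
    intro ν hν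
    by_contra h
    have hmem : ν ≤ B := hB (by
      simp only [Set.mem_ofPred_eq]
      convert h using 1
      simp [Matrix.det_fin_three, cross_apply, dotProduct, Fin.sum_univ_three]
      ring)
    omega
  obtain ⟨δ, hδ, j, hj⟩ := hα.exists_pos_le_abs_cross (hne (B + 1))
  obtain ⟨N, hN⟩ := hm.exists_heightLF_mul_zetaLF_lt hδ
  set ν := max N (B + 1)
  obtain ⟨h1, h2⟩ := dotProduct_cross_eq_zero hne hdet (le_max_right N (B + 1))
  have hlow := hj _ _ h1 h2 (hne ν)
  have hup := abs_cross_cross_le α (hm.2.1 ν).le (hz ν) j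
  exact absurd (hN ν (le_max_left _ _)) (not_lt.2 (hlow.trans hup))
end

section
/- Let r ≥ 2 and let ψ : [1,∞) → (0,∞) be a function decreasing to 0 as y → ∞. Then there exists an uncountable set of r-tuples α = (α₁,…,α_r) ∈ ℝ^r, each with 1, α₁, …, α_r linearly independent over ℚ, such that for all corresponding best approximations (in the sense of linear form) one has ζ_ν ≤ ψ(M_{ν+r−1}) for every ν. -/
open scoped BigOperators

section LinearForm

variable {r : ℕ}

/-- The affine form `α ↦ m₀ + m₁α₁ + … + m_rα_r`. -/
noncomputable def affForm (α : Fin r → ℝ) (m : Fin (r + 1) → ℤ) : ℝ :=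
  (m 0 : ℝ) + ∑ j : Fin r, (m j.succ : ℝ) * α j

/-- The linear part `d ↦ m₁d₁ + … + m_rd_r` of the affine form attached to `m`. -/
noncomputable def linPart (d : Fin r → ℝ) (m : Fin (r + 1) → ℤ) : ℝ :=
  ∑ j : Fin r, (m j.succ : ℝ) * d j

lemma zetaLF_eq_abs_affForm (α : Fin r → ℝ) (m : Fin (r + 1) → ℤ) :
    zetaLF α m = |affForm α m| := rfl

lemma affForm_add_smul (a d : Fin r → ℝ) (t : ℝ) (m : Fin (r + 1) → ℤ) :
    affForm (a + t • d) m = affForm a m + t * linPart d m := by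
  simp only [affForm, linPart, Pi.add_apply, Pi.smul_apply, smul_eq_mul, Finset.mul_sum,
    mul_add, Finset.sum_add_distrib, add_assoc]
  congr 2
  exact Finset.sum_congr rfl fun _ _ => by ring

lemma linPart_add_smul (a d : Fin r → ℝ) (t : ℝ) (m : Fin (r + 1) → ℤ) :
    linPart (a + t • d) m = linPart a m + t * linPart d m := by
  simp only [linPart, Pi.add_apply, Pi.smul_apply, smul_eq_mul, Finset.mul_sum,
    mul_add, Finset.sum_add_distrib]
  congr 1
  exact Finset.sum_congr rfl fun _ _ => by ring

lemma linPart_smul (d : Fin r → ℝ) (t : ℝ) (m : Fin (r + 1) → ℤ) :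
    linPart (t • d) m = t * linPart d m := by
  simp only [linPart, Pi.smul_apply, smul_eq_mul, Finset.mul_sum]
  exact Finset.sum_congr rfl fun _ _ => by ring

lemma affForm_single_add_smul (a : Fin r → ℝ) (N : ℤ) (w : Fin (r + 1) → ℤ) :
    affForm a (Pi.single 0 1 + N • w) = 1 + N * affForm a w := by
  simp [affForm, mul_add, Finset.mul_sum, mul_assoc, add_assoc]

lemma linPart_single_add_smul (d : Fin r → ℝ) (N : ℤ) (w : Fin (r + 1) → ℤ) :
    linPart d (Pi.single 0 1 + N • w) = N * linPart d w := by
  simp [linPart, Finset.mul_sum, mul_assoc]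

lemma continuous_affForm (m : Fin (r + 1) → ℤ) :
    Continuous fun α : Fin r → ℝ => affForm α m := by
  unfold affForm
  fun_prop

lemma finite_heightLF_le (H : ℕ) : {n : Fin (r + 1) → ℤ | heightLF n ≤ H}.Finite := by
  refine (Set.finite_Icc (fun _ => -(H : ℤ)) (fun _ => (H : ℤ))).subset fun n hn => ?_
  have h : ∀ j, (n j).natAbs ≤ H := fun j =>
    (Finset.le_sup (f := fun j => (n j).natAbs) (Finset.mem_univ j)).trans hn
  constructor <;> intro j <;> have := h j <;> dsimp only <;> omega

lemma one_le_heightLF {n : Fin (r + 1) → ℤ} (hn : n ≠ 0) : 1 ≤ heightLF n := by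
  obtain ⟨j, hj⟩ := Function.ne_iff.1 hn
  exact (Int.natAbs_pos.2 hj).trans_le
    (Finset.le_sup (f := fun j => (n j).natAbs) (Finset.mem_univ j))

lemma ne_zero_of_heightLF_pos {n : Fin (r + 1) → ℤ} (hn : 0 < heightLF n) : n ≠ 0 := by
  rintro rfl
  simp [heightLF] at hn

lemma heightLF_single (j : Fin (r + 1)) : heightLF (Pi.single j 1 : Fin (r + 1) → ℤ) = 1 := by
  refine le_antisymm (Finset.sup_le fun i _ => ?_) (one_le_heightLF (by simp))
  by_cases h : i = j
  · subst h; simp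
  · simp [h]

lemma exists_isBestApproxLF {α : Fin r → ℝ} {v : Fin (r + 1) → ℤ} (hv : v ≠ 0)
    (hmin : ∀ n, n ≠ 0 → heightLF n < heightLF v → zetaLF α v < zetaLF α n) :
    ∃ n, IsBestApproxLF α n ∧ heightLF n = heightLF v := by
  have hfin : {n : Fin (r + 1) → ℤ | n ≠ 0 ∧ heightLF n ≤ heightLF v}.Finite :=
    (finite_heightLF_le (heightLF v)).subset fun n hn => hn.2
  obtain ⟨n, ⟨hn0, hnv⟩, hn⟩ := hfin.exists_minimalFor (zetaLF α) _ ⟨v, hv, le_rfl⟩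
  have hn' : ∀ p, p ≠ 0 → heightLF p ≤ heightLF v → zetaLF α n ≤ zetaLF α p :=
    fun p hp0 hpv => (le_total (zetaLF α n) (zetaLF α p)).elim id (hn ⟨hp0, hpv⟩)
  refine ⟨n, ⟨hn0, fun p hp0 hp => hn' p hp0 (hp.trans hnv)⟩, hnv.antisymm ?_⟩
  by_contra! hlt
  exact (hmin n hn0 hlt).not_ge (hn' v hv le_rfl)

lemma qIndepLF_of_witness {α : Fin r → ℝ} {v : ℕ → Fin (r + 1) → ℤ}
    (hmono : StrictMono fun k => heightLF (v k))
    (hmin : ∀ k n, n ≠ 0 → heightLF n < heightLF (v k) → zetaLF α (v k) < zetaLF α n) :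
    QIndepLF α := by
  intro c hc
  by_contra hc0
  have h := hmin (heightLF c + 1) c hc0 (Nat.lt_of_succ_le (hmono.le_apply (x := heightLF c + 1)))
  rw [zetaLF_eq_abs_affForm α c, affForm, hc, abs_zero] at h
  exact h.not_ge (abs_nonneg _)

lemma zetaLF_le_of_witness (hr : 2 ≤ r) {ψ : ℝ → ℝ} (hψ : AntitoneOn ψ (Set.Ici 1))
    {α : Fin r → ℝ} {v : ℕ → Fin (r + 1) → ℤ}
    (hmono : StrictMono fun k => heightLF (v k)) (h0 : heightLF (v 0) = 1)
    (hmin : ∀ k n, n ≠ 0 → heightLF n < heightLF (v k) → zetaLF α (v k) < zetaLF α n)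
    (hle : ∀ k, zetaLF α (v k) ≤ ψ (heightLF (v (k + r - 1))))
    {m : ℕ → Fin (r + 1) → ℤ} (hm : IsBestApproxSeqLF α m) (ν : ℕ) :
    zetaLF α (m ν) ≤ ψ (heightLF (m (ν + r - 1))) := by
  obtain ⟨hbest, hlt, hex⟩ := hm
  have hmm : StrictMono fun ν => heightLF (m ν) := strictMono_nat_of_lt_succ hlt
  have hv1 : ∀ k, 1 ≤ heightLF (v k) := fun k => h0 ▸ hmono.monotone (Nat.zero_le k)
  have hv : ∀ k, v k ≠ 0 := fun k => ne_zero_of_heightLF_pos (hv1 k)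
  have hμ : ∀ k, ∃ μ, heightLF (m μ) = heightLF (v k) := fun k => by
    obtain ⟨n, hn, hnk⟩ := exists_isBestApproxLF (hv k) (hmin k)
    obtain ⟨μ, h⟩ := hex n hn
    exact ⟨μ, h.trans hnk⟩
  choose μ hμ using hμ
  have hμmono : StrictMono μ := fun i j hij =>
    hmm.lt_iff_lt.1 (by simpa only [hμ] using hmono hij)
  obtain ⟨k, hk, hk'⟩ : ∃ k, heightLF (v k) ≤ heightLF (m ν) ∧
      heightLF (m ν) < heightLF (v (k + 1)) := by
    have hP : ∃ k, heightLF (m ν) < heightLF (v k) :=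
      ⟨heightLF (m ν) + 1, Nat.lt_of_succ_le (hmono.le_apply (x := heightLF (m ν) + 1))⟩
    classical
    have hpos : Nat.find hP ≠ 0 := fun h => by
      have h1 := Nat.find_spec hP
      rw [h, h0] at h1
      exact h1.not_ge (one_le_heightLF (hbest ν).1)
    obtain ⟨k, hk⟩ := Nat.exists_eq_succ_of_ne_zero hpos
    exact ⟨k, not_lt.1 (Nat.find_min hP (by omega)), by simpa only [hk] using Nat.find_spec hP⟩
  have hind : ∀ j, ν + 1 + j ≤ μ (k + 1 + j) := fun j => by
    induction j with
    | zero => exact hmm.lt_iff_lt.1 (by simpa only [hμ] using hk')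
    | succ j ih => exact Nat.succ_le_of_lt (ih.trans_lt (hμmono (Nat.lt_succ_self _)))
  have hheight : heightLF (m (ν + r - 1)) ≤ heightLF (v (k + r - 1)) := by
    have h := hind (r - 2)
    rw [show ν + 1 + (r - 2) = ν + r - 1 by omega, show k + 1 + (r - 2) = k + r - 1 by omega] at h
    exact hμ (k + r - 1) ▸ hmm.monotone h
  calc zetaLF α (m ν) ≤ zetaLF α (v k) := (hbest ν).2 _ (hv k) hk
    _ ≤ ψ (heightLF (v (k + r - 1))) := hle k
    _ ≤ _ := hψ (by simpa using one_le_heightLF (hbest _).1) (by simpa using hv1 _)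
        (by exact_mod_cast hheight)

/-- `w₀, …, w_{r-1}` are integer vectors of nondecreasing heights vanishing at the point `a`, with
dual system of directions `d₀, …, d_{r-1}`; every integer vector vanishing at `a` which involves
`w_i` is at least as high as `w_i`. -/
structure IsMinimalSystem (a : Fin r → ℝ) (w : ℕ → Fin (r + 1) → ℤ) (d : ℕ → Fin r → ℝ) :
    Prop where
  affForm_eq : ∀ i < r, affForm a (w i) = 0
  linPart_eq : ∀ i < r, ∀ j < r, linPart (d i) (w j) = if i = j then 1 else 0
  eq_zero : ∀ n, affForm a n = 0 → (∀ i < r, linPart (d i) n = 0) → n = 0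
  height_le : ∀ n, affForm a n = 0 → ∀ i < r, linPart (d i) n ≠ 0 → heightLF (w i) ≤ heightLF n
  height_mono : ∀ i j, i ≤ j → j < r → heightLF (w i) ≤ heightLF (w j)

/-- At `x`, the vector `w₀` is closer to vanishing than all lower nonzero integer vectors,
and also than `ψ` at the height of `w_{r-1}`. -/
def IsGoodAt (ψ : ℝ → ℝ) (w : ℕ → Fin (r + 1) → ℤ) (x : Fin r → ℝ) : Prop :=
  zetaLF x (w 0) ≤ ψ (heightLF (w (r - 1))) ∧
    ∀ n, n ≠ 0 → heightLF n < heightLF (w 0) → zetaLF x (w 0) < zetaLF x n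

lemma IsMinimalSystem.ne_zero {a : Fin r → ℝ} {w : ℕ → Fin (r + 1) → ℤ} {d : ℕ → Fin r → ℝ}
    (h : IsMinimalSystem a w d) {i : ℕ} (hi : i < r) : w i ≠ 0 := by
  intro h0
  have := h.linPart_eq i hi i hi
  simp [h0, linPart] at this

lemma IsMinimalSystem.eventually_isGoodAt (hr : 0 < r) {ψ : ℝ → ℝ}
    (hψ : ∀ y : ℝ, 1 ≤ y → 0 < ψ y) {a : Fin r → ℝ} {w : ℕ → Fin (r + 1) → ℤ}
    {d : ℕ → Fin r → ℝ} (h : IsMinimalSystem a w d) :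
    ∀ᶠ x in nhds a, IsGoodAt ψ w x := by
  have hcont : ∀ n : Fin (r + 1) → ℤ, Continuous fun x : Fin r → ℝ => zetaLF x n :=
    fun n => (continuous_affForm n).abs
  have hz : zetaLF a (w 0) = 0 := by
    rw [zetaLF_eq_abs_affForm, h.affForm_eq 0 hr, abs_zero]
  refine Filter.Eventually.and ?_ ?_
  · have hpos : zetaLF a (w 0) < ψ (heightLF (w (r - 1))) := by
      rw [hz]
      exact hψ _ (by exact_mod_cast one_le_heightLF (h.ne_zero (by omega)))
    exact ((hcont _).continuousAt.eventually_lt continuousAt_const hpos).mono fun _ hx => hx.le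
  · have hfin := finite_heightLF_le (r := r) (heightLF (w 0))
    have key : ∀ n ∈ {n : Fin (r + 1) → ℤ | heightLF n ≤ heightLF (w 0)},
        ∀ᶠ x in nhds a, n ≠ 0 → heightLF n < heightLF (w 0) → zetaLF x (w 0) < zetaLF x n := by
      intro n _
      by_cases hn : n ≠ 0 ∧ heightLF n < heightLF (w 0)
      · have hna : affForm a n ≠ 0 := fun hna => hn.1 <| h.eq_zero n hna fun i hi => by
          by_contra hne
          exact hn.2.not_ge ((h.height_mono 0 i (Nat.zero_le i) hi).trans
            (h.height_le n hna i hi hne))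
        have hlt : zetaLF a (w 0) < zetaLF a n := by
          rw [hz, zetaLF_eq_abs_affForm]
          exact abs_pos.2 hna
        exact ((hcont _).continuousAt.eventually_lt (hcont _).continuousAt hlt).mono
          fun _ hx _ _ => hx
      · exact Filter.Eventually.of_forall fun x h1 h2 => absurd ⟨h1, h2⟩ hn
    filter_upwards [(Filter.eventually_all_finite hfin).2 key] with x hx n hn0 hn
    exact hx n hn.le hn0 hn

lemma isMinimalSystem_zero : ∃ (w : ℕ → Fin (r + 1) → ℤ) (d : ℕ → Fin r → ℝ),
    IsMinimalSystem 0 w d ∧ ∀ i < r, heightLF (w i) = 1 := by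
  have hw : ∀ i, i < r → heightLF
      (if h : i < r then Pi.single (Fin.succ ⟨i, h⟩) 1 else 0 : Fin (r + 1) → ℤ) = 1 :=
    fun i hi => by rw [dif_pos hi, heightLF_single]
  have hlin : ∀ (i : ℕ) (hi : i < r) (n : Fin (r + 1) → ℤ), linPart
      (if h : i < r then Pi.single ⟨i, h⟩ 1 else 0 : Fin r → ℝ) n = n (Fin.succ ⟨i, hi⟩) := by
    intro i hi n
    simp [linPart, hi, Pi.single_apply]
  refine ⟨fun i => if h : i < r then Pi.single (Fin.succ ⟨i, h⟩) 1 else 0,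
    fun i => if h : i < r then Pi.single ⟨i, h⟩ 1 else 0, ⟨?_, ?_, ?_, ?_, ?_⟩, hw⟩
  · intro i hi
    simp [affForm, hi, Pi.single_apply, Fin.ext_iff]
  · intro i hi j hj
    rw [hlin i hi]
    simp [hj, Pi.single_apply, Fin.ext_iff]
  · intro n hn h
    funext j
    refine Fin.cases ?_ (fun j => ?_) j
    · simpa [affForm] using hn
    · have := h j j.2
      rw [hlin j j.2] at this
      exact_mod_cast this
  · intro n _ i hi h
    rw [hw i hi]
    refine one_le_heightLF ?_
    rintro rfl
    exact h (by simp [linPart])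
  · intro i j hij hj
    rw [hw i (by omega), hw j hj]

lemma IsMinimalSystem.exists_next (hr : 0 < r) {a : Fin r → ℝ} {w : ℕ → Fin (r + 1) → ℤ}
    {d : ℕ → Fin r → ℝ} (h : IsMinimalSystem a w d) {U : Set (Fin r → ℝ)} (hU : U ∈ nhds a)
    (β : Fin r → ℝ) :
    ∃ a' ∈ U, a' ≠ β ∧ ∃ w' d', IsMinimalSystem a' w' d' ∧ (∀ i, i + 1 < r → w' i = w (i + 1)) ∧
      heightLF (w (r - 1)) < heightLF (w' (r - 1)) := by
  have hlin0 : linPart (d 0) (w 0) = 1 := by simpa using h.linPart_eq 0 hr 0 hr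
  have hd0 : d 0 ≠ 0 := fun h0 => by simp [h0, linPart] at hlin0
  have ht : Filter.Tendsto (fun t : ℝ => a + t • d 0) (nhds 0) (nhds a) := by
    have : Continuous fun t : ℝ => a + t • d 0 := by fun_prop
    simpa using this.tendsto 0
  have hN : Filter.Tendsto (fun N : ℕ => -(1 / ((N : ℝ) + 1))) Filter.atTop (nhds 0) := by
    simpa using (tendsto_one_div_add_atTop_nhds_zero_nat (𝕜 := ℝ)).neg
  have hne : ∀ N : ℕ, ((N : ℝ) + 1) ≠ 0 := fun N => by positivity
  have hev1 : ∀ᶠ N : ℕ in Filter.atTop, a + (-(1 / ((N : ℝ) + 1))) • d 0 ∈ U :=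
    (ht.comp hN).eventually hU
  have hev2 : ∀ᶠ N : ℕ in Filter.atTop, a + (-(1 / ((N : ℝ) + 1))) • d 0 ≠ β := by
    by_cases hβ : a = β
    · refine Filter.Eventually.of_forall fun N hN => ?_
      rw [← hβ, add_eq_left, smul_eq_zero] at hN
      exact hN.elim (neg_ne_zero.2 (one_div_ne_zero (hne N))) hd0
    · exact (ht.comp hN).eventually_ne hβ
  have hev3 : ∀ᶠ N : ℕ in Filter.atTop,
      ∀ n ∈ {n : Fin (r + 1) → ℤ | heightLF n ≤ heightLF (w (r - 1))},
        linPart (d 0) n ≠ 0 → affForm (a + (-(1 / ((N : ℝ) + 1))) • d 0) n ≠ 0 := by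
    refine (Filter.eventually_all_finite (finite_heightLF_le _)).2 fun n _ => ?_
    by_cases hna : affForm a n = 0
    · refine Filter.Eventually.of_forall fun N hl => ?_
      rw [affForm_add_smul, hna, zero_add]
      exact mul_ne_zero (neg_ne_zero.2 (one_div_ne_zero (hne N))) hl
    · have hc := ((continuous_affForm n).tendsto a).comp (ht.comp hN)
      exact (hc.eventually_ne hna).mono fun N hN _ => hN
  obtain ⟨N, hNU, hNβ, hNh⟩ := (hev1.and (hev2.and hev3)).exists
  set t : ℝ := -(1 / ((N : ℝ) + 1)) with ht_def
  have haff : ∀ n, affForm (a + t • d 0) n = affForm a n + t * linPart (d 0) n :=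
    affForm_add_smul a (d 0) t
  have hP : ∃ n, affForm (a + t • d 0) n = 0 ∧ linPart (d 0) n ≠ 0 := by
    refine ⟨Pi.single 0 1 + ((N : ℤ) + 1) • w 0, ?_, ?_⟩
    · rw [affForm_single_add_smul, haff, h.affForm_eq 0 hr, hlin0, ht_def]
      push_cast
      field_simp [hne N]
      ring
    · rw [linPart_single_add_smul, hlin0]
      push_cast
      simpa using hne N
  obtain ⟨x, ⟨hx0, hxd⟩, hxmin⟩ :
      ∃ x, (affForm (a + t • d 0) x = 0 ∧ linPart (d 0) x ≠ 0) ∧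
        ∀ n, affForm (a + t • d 0) n = 0 → linPart (d 0) n ≠ 0 → heightLF x ≤ heightLF n := by
    obtain ⟨x, hx, hmin⟩ := exists_minimalFor_of_wellFoundedLT
      (fun n => affForm (a + t • d 0) n = 0 ∧ linPart (d 0) n ≠ 0) heightLF hP
    exact ⟨x, hx, fun n h1 h2 =>
      (le_total (heightLF x) (heightLF n)).elim id (hmin ⟨h1, h2⟩)⟩
  have hxh : heightLF (w (r - 1)) < heightLF x := by
    by_contra! hle
    exact hNh x hle hxd hx0
  have hxh' : ∀ i < r, heightLF (w i) ≤ heightLF x := fun i hi =>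
    (h.height_mono i (r - 1) (by omega) (by omega)).trans hxh.le
  have hback : ∀ n, affForm (a + t • d 0) n = 0 → linPart (d 0) n = 0 → affForm a n = 0 := by
    intro n h1 h2
    rw [haff, h2, mul_zero, add_zero] at h1
    exact h1
  refine ⟨a + t • d 0, hNU, hNβ, fun i => if i + 1 < r then w (i + 1) else x,
    fun i => if i + 1 < r then d (i + 1) + (-(linPart (d (i + 1)) x / linPart (d 0) x)) • d 0
      else (linPart (d 0) x)⁻¹ • d 0, ⟨?_, ?_, ?_, ?_, ?_⟩, fun i hi => if_pos hi, ?_⟩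
  · intro i hi
    split_ifs with h1
    · rw [haff, h.affForm_eq _ h1, h.linPart_eq 0 hr _ h1]
      simp
    · exact hx0
  · intro i hi j hj
    by_cases h1 : i + 1 < r <;> by_cases h2 : j + 1 < r <;>
      simp only [h1, h2, if_true, if_false, linPart_add_smul, linPart_smul]
    · rw [h.linPart_eq _ h1 _ h2, h.linPart_eq 0 hr _ h2]
      simp
    · rw [if_neg (by omega)]
      field_simp
      ring
    · rw [h.linPart_eq 0 hr _ h2, if_neg (by omega), if_neg (by omega), mul_zero]
    · rw [if_pos (by omega)]
      exact inv_mul_cancel₀ hxd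
  · intro n hn hnd
    have hn0 : linPart (d 0) n = 0 := by
      have := hnd (r - 1) (by omega)
      rw [if_neg (by omega), linPart_smul] at this
      exact (mul_eq_zero.1 this).resolve_left (inv_ne_zero hxd)
    refine h.eq_zero n (hback n hn hn0) fun i hi => ?_
    rcases i with _ | i
    · exact hn0
    · have := hnd i (by omega)
      rwa [if_pos hi, linPart_add_smul, hn0, mul_zero, add_zero] at this
  · intro n hn i hi hne
    by_cases hn0 : linPart (d 0) n = 0
    · split_ifs at hne ⊢ with h1
      · rw [linPart_add_smul, hn0, mul_zero, add_zero] at hne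
        exact h.height_le n (hback n hn hn0) _ h1 hne
      · exact absurd (by rw [linPart_smul, hn0, mul_zero]) hne
    · have hle := hxmin n hn hn0
      split_ifs with h1
      · exact (hxh' _ h1).trans hle
      · exact hle
  · intro i j hij hj
    split_ifs with h1 h2 h2
    · exact h.height_mono _ _ (by omega) h2
    · exact hxh' _ h1
    · omega
    · exact le_rfl
  · simpa only [if_neg (show ¬ r - 1 + 1 < r by omega)] using hxh

lemma exists_witness (hr : 2 ≤ r) {ψ : ℝ → ℝ} (hψ : ∀ y : ℝ, 1 ≤ y → 0 < ψ y)
    (β : ℕ → Fin r → ℝ) :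
    ∃ (α : Fin r → ℝ) (v : ℕ → Fin (r + 1) → ℤ), (∀ j, α ≠ β j) ∧
      StrictMono (fun k => heightLF (v k)) ∧ heightLF (v 0) = 1 ∧
      (∀ k n, n ≠ 0 → heightLF n < heightLF (v k) → zetaLF α (v k) < zetaLF α n) ∧
      ∀ k, zetaLF α (v k) ≤ ψ (heightLF (v (k + r - 1))) := by
  have hr0 : 0 < r := by omega
  let T := (ℕ → Fin (r + 1) → ℤ) × (Fin r → ℝ) × ℝ
  let K : T → Set (Fin r → ℝ) := fun s => Metric.closedBall s.2.1 s.2.2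
  let P : T → Prop := fun s => (∃ d, IsMinimalSystem s.2.1 s.1 d) ∧ 0 < s.2.2 ∧
    ∀ x ∈ K s, IsGoodAt ψ s.1 x
  have hstep : ∀ (k : ℕ) (s : {s // P s}), ∃ s' : {s // P s}, K s'.1 ⊆ K s.1 ∧ β k ∉ K s'.1 ∧
      (∀ i, i + 1 < r → s'.1.1 i = s.1.1 (i + 1)) ∧
      heightLF (s.1.1 (r - 1)) < heightLF (s'.1.1 (r - 1)) := by
    rintro k ⟨⟨w, a, ε⟩, ⟨d, hd⟩, hε, -⟩
    obtain ⟨a', ha', haβ, w', d', hd', hw', hh⟩ :=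
      hd.exists_next hr0 (Metric.ball_mem_nhds a hε) (β k)
    have hev : ∀ᶠ x in nhds a', x ∈ Metric.ball a ε ∧ x ≠ β k ∧ IsGoodAt ψ w' x :=
      Filter.Eventually.and (Metric.isOpen_ball.mem_nhds ha')
        (Filter.Eventually.and (isOpen_ne.mem_nhds haβ) (hd'.eventually_isGoodAt hr0 hψ))
    obtain ⟨ε', hε', hsub⟩ := Metric.nhds_basis_closedBall.eventually_iff.1 hev
    exact ⟨⟨⟨w', a', ε'⟩, ⟨d', hd'⟩, hε', fun x hx => (hsub hx).2.2⟩,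
      fun x hx => Metric.ball_subset_closedBall (hsub hx).1, fun hx => (hsub hx).2.1 rfl, hw', hh⟩
  obtain ⟨s₀, hs₀⟩ : ∃ s : {s // P s}, heightLF (s.1.1 (r - 1)) = 1 := by
    obtain ⟨w, d, hd, hw⟩ := isMinimalSystem_zero (r := r)
    obtain ⟨ε, hε, hsub⟩ :=
      Metric.nhds_basis_closedBall.eventually_iff.1 (hd.eventually_isGoodAt hr0 hψ)
    exact ⟨⟨⟨w, 0, ε⟩, ⟨d, hd⟩, hε, fun x hx => hsub hx⟩, hw _ (by omega)⟩
  choose f hfK hfβ hfw hfh using hstep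
  let s : ℕ → {s // P s} := fun k => Nat.rec s₀ f k
  have hwin : ∀ i k, i < r → (s k).1.1 i = (s (k + i)).1.1 0 := by
    intro i
    induction i with
    | zero => intro k _; rfl
    | succ i ih =>
      intro k hi
      rw [← hfw k (s k) i hi, show k + (i + 1) = k + 1 + i by omega]
      exact ih (k + 1) (by omega)
  have hlast : ∀ k, (s k).1.1 (r - 1) = (s (k + (r - 1))).1.1 0 :=
    fun k => hwin _ k (by omega)
  obtain ⟨α, hα⟩ : (⋂ k, K (s k).1).Nonempty :=
    IsCompact.nonempty_iInter_of_sequence_nonempty_isCompact_isClosed _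
      (fun k => hfK k (s k)) (fun k => Metric.nonempty_closedBall.2 (s k).2.2.1.le)
      (isCompact_closedBall _ _) fun k => Metric.isClosed_closedBall
  rw [Set.mem_iInter] at hα
  have hgood := fun k => (s k).2.2.2 α (hα k)
  refine ⟨α, fun k => (s k).1.1 (r - 1), fun j hj => hfβ j (s j) (hj ▸ hα (j + 1)),
    strictMono_nat_of_lt_succ fun k => hfh k (s k), hs₀, fun k => ?_, fun k => ?_⟩
  · simpa only [hlast] using (hgood (k + (r - 1))).2
  · have := (hgood (k + (r - 1))).1
    rwa [← hlast, show k + (r - 1) = k + r - 1 by omega] at this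

end LinearForm

/-- Let `r ≥ 2` and `ψ : [1,∞) → (0,∞)` decrease to `0`. There is an
uncountable set of `r`-tuples `α` with `1, α₁, …, α_r` `ℚ`-linearly independent, whose
best approximations satisfy `ζ_ν ≤ ψ(M_{ν+r−1})` for every `ν`. -/
theorem stmt3 (r : ℕ) (hr : 2 ≤ r) (ψ : ℝ → ℝ)
    (hψpos : ∀ y : ℝ, 1 ≤ y → 0 < ψ y)
    (hψanti : AntitoneOn ψ (Set.Ici 1))
    (hψ0 : Filter.Tendsto ψ Filter.atTop (nhds 0)) :
    ∃ S : Set (Fin r → ℝ), ¬ S.Countable ∧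
      ∀ α ∈ S, QIndepLF α ∧
        ∀ m : ℕ → Fin (r + 1) → ℤ, IsBestApproxSeqLF α m →
          ∀ ν : ℕ, zetaLF α (m ν) ≤ ψ ((heightLF (m (ν + r - 1)) : ℝ)) := by
  refine ⟨{α | QIndepLF α ∧ ∀ m : ℕ → Fin (r + 1) → ℤ, IsBestApproxSeqLF α m →
    ∀ ν : ℕ, zetaLF α (m ν) ≤ ψ ((heightLF (m (ν + r - 1)) : ℝ))}, fun hS => ?_, fun α hα => hα⟩
  obtain ⟨β, hβ⟩ := Set.countable_iff_exists_subset_range.1 hS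
  obtain ⟨α, v, hαβ, hmono, h0, hmin, hle⟩ := exists_witness hr hψpos β
  obtain ⟨j, hj⟩ := hβ (show α ∈ _ from
    ⟨qIndepLF_of_witness hmono hmin, fun m hm ν =>
      zetaLF_le_of_witness hr hψanti hmono h0 hmin hle hm ν⟩)
  exact hαβ j hj.symm
end

section
/- For any s ≥ 1 and any α = (α₁,…,α_s) ∈ ℝ^s with α ∉ ℚ^s, one has R(α) = dim_ℤ α; that is, the minimal rank of a sublattice of ℤ^{s+1} containing all but finitely many best simultaneous approximations to α equals the dimension of the ℚ-vector space spanned by 1, α₁, …, α_s. -/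
open scoped BigOperators

/-- `D(ζ) = max_{1≤j≤s} |p α_j − a_j|` where `ζ = (p, a₁, …, a_s)`
(the norm is the sup norm on `Fin s → ℝ`). -/
noncomputable def Derr {s : ℕ} (α : Fin s → ℝ) (ζ : Fin (s + 1) → ℤ) : ℝ :=
  ‖(fun j : Fin s => (ζ 0 : ℝ) * α j - (ζ j.succ : ℝ))‖

/-- `ζ = (p, a₁, …, a_s)` with `p ≥ 1` is a best simultaneous approximation to `α`:
`D(ζ) < D(η)` for every integer point `η = (q, b)` with `1 ≤ q ≤ p` and `b ≠ a`. -/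
def IsBSA {s : ℕ} (α : Fin s → ℝ) (ζ : Fin (s + 1) → ℤ) : Prop :=
  1 ≤ ζ 0 ∧ ∀ η : Fin (s + 1) → ℤ, 1 ≤ η 0 → η 0 ≤ ζ 0 →
    (fun j : Fin s => η j.succ) ≠ (fun j : Fin s => ζ j.succ) →
    Derr α ζ < Derr α η

/-- `ζ : ℕ → ℤ^{s+1}` is the (exhaustive) sequence of all best simultaneous
approximations to `α`, with strictly increasing `p`. -/
def IsBSASeq {s : ℕ} (α : Fin s → ℝ) (ζ : ℕ → Fin (s + 1) → ℤ) : Prop :=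
  (∀ ν : ℕ, IsBSA α (ζ ν)) ∧
  (∀ ν : ℕ, ζ ν 0 < ζ (ν + 1) 0) ∧
  (∀ η : Fin (s + 1) → ℤ, IsBSA α η → ∃ ν : ℕ, ζ ν = η)

/-- `dim_ℤ α`: the dimension of the `ℚ`-vector space spanned by `1, α₁, …, α_s`. -/
noncomputable def dimZ {s : ℕ} (α : Fin s → ℝ) : ℕ :=
  Module.finrank ℚ ↥(Submodule.span ℚ (insert (1 : ℝ) (Set.range α)))

lemma abs_coord_le_Derr {s : ℕ} (α : Fin s → ℝ) (z : Fin (s + 1) → ℤ) (j : Fin s) :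
    |(z 0 : ℝ) * α j - z j.succ| ≤ Derr α z := by
  have h := norm_le_pi_norm (fun j : Fin s => (z 0 : ℝ) * α j - (z j.succ : ℝ)) j
  simpa [Derr, Real.norm_eq_abs] using h

lemma Derr_nonneg {s : ℕ} (α : Fin s → ℝ) (z : Fin (s + 1) → ℤ) : 0 ≤ Derr α z :=
  norm_nonneg _

/-- Simultaneous Dirichlet approximation (without a rate). -/
lemma exists_Derr_lt {s : ℕ} (α : Fin s → ℝ) {ε : ℝ} (hε : 0 < ε) :
    ∃ η : Fin (s + 1) → ℤ, 1 ≤ η 0 ∧ Derr α η < ε := by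
  let x : ℕ → Fin s → ℝ := fun n j => Int.fract ((n : ℝ) * α j)
  have hx : ∀ n, x n ∈ Set.Icc (0 : Fin s → ℝ) 1 := fun n =>
    ⟨fun j => Int.fract_nonneg _, fun j => (Int.fract_lt_one _).le⟩
  obtain ⟨a, -, φ, hφ, hlim⟩ := isCompact_Icc.tendsto_subseq hx
  obtain ⟨N, hN⟩ := Metric.cauchySeq_iff'.1 hlim.cauchySeq ε hε
  have hd := hN (N + 1) (Nat.le_succ N)
  have hlt : φ N < φ (N + 1) := hφ (Nat.lt_succ_self N)
  refine ⟨Fin.cons ((φ (N + 1) : ℤ) - φ N)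
    fun j => ⌊(φ (N + 1) : ℝ) * α j⌋ - ⌊(φ N : ℝ) * α j⌋, ?_, ?_⟩
  · simp only [Fin.cons_zero]
    omega
  · rw [dist_eq_norm] at hd
    convert hd using 1
    unfold Derr
    congr 1
    funext j
    simp only [Fin.cons_zero, Fin.cons_succ, Function.comp_apply, Pi.sub_apply, x, Int.fract]
    push_cast
    ring

lemma IsBSA.Derr_le_half {s : ℕ} {α : Fin s → ℝ} {z : Fin (s + 1) → ℤ} (hz : IsBSA α z) :
    Derr α z ≤ 1 / 2 := by
  let η : Fin (s + 1) → ℤ := Fin.cons (z 0) fun j => round ((z 0 : ℝ) * α j)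
  have hη : Derr α η ≤ 1 / 2 := by
    refine (pi_norm_le_iff_of_nonneg (by norm_num)).2 fun j => ?_
    simpa [η, Real.norm_eq_abs] using abs_sub_round ((z 0 : ℝ) * α j)
  by_cases h : (fun j : Fin s => η j.succ) = fun j : Fin s => z j.succ
  · have : η = z := by
      funext i
      refine Fin.cases rfl (fun j => congrFun h j) i
    rwa [← this]
  · exact (hz.2 η hz.1 le_rfl h).le.trans hη

/-- Best approximations with large denominator have small error. -/
lemma exists_Derr_lt_of_isBSA {s : ℕ} {α : Fin s → ℝ} (hα : α ≠ 0) {ε : ℝ} (hε : 0 < ε) :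
    ∃ P : ℤ, ∀ z, IsBSA α z → P ≤ z 0 → Derr α z < ε := by
  obtain ⟨η, h1, h2⟩ := exists_Derr_lt α hε
  obtain ⟨j, hj⟩ := Function.ne_iff.1 hα
  have hj' : 0 < |α j| := abs_pos.2 hj
  obtain ⟨P, hP⟩ := exists_int_gt ((1 / 2 + |(η j.succ : ℝ)|) / |α j|)
  refine ⟨max P (η 0), fun z hz hle => ?_⟩
  refine (hz.2 η h1 (le_trans (le_max_right _ _) hle) fun heq => ?_).trans h2
  have hη : η j.succ = z j.succ := congrFun heq j
  have hc := (abs_coord_le_Derr α z j).trans hz.Derr_le_half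
  rw [← hη] at hc
  have hz0 : (P : ℝ) ≤ z 0 := by exact_mod_cast le_trans (le_max_left _ _) hle
  have hz1 : (1 : ℝ) ≤ z 0 := by exact_mod_cast hz.1
  have h3 : 1 / 2 + |(η j.succ : ℝ)| < z 0 * |α j| := by
    rw [← div_lt_iff₀ hj']
    exact hP.trans_le hz0
  have h4 := abs_sub_abs_le_abs_sub ((z 0 : ℝ) * α j) (η j.succ)
  rw [abs_mul, abs_of_pos (by linarith : (0 : ℝ) < z 0)] at h4
  linarith

lemma IsBSASeq.le_apply_zero {s : ℕ} {α : Fin s → ℝ} {ζ : ℕ → Fin (s + 1) → ℤ}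
    (hζ : IsBSASeq α ζ) (ν : ℕ) : (ν : ℤ) ≤ ζ ν 0 := by
  induction ν with
  | zero => exact_mod_cast zero_le_one.trans (hζ.1 0).1
  | succ n ih =>
    have := hζ.2.1 n
    push_cast
    omega

/-- The embedding of the integer lattice into rational space. -/
def intToRat (n : ℕ) : (Fin n → ℤ) →ₗ[ℤ] (Fin n → ℚ) where
  toFun z i := z i
  map_add' _ _ := by ext; simp
  map_smul' _ _ := by ext; simp

@[simp] lemma intToRat_apply {n : ℕ} (z : Fin n → ℤ) (i : Fin n) : intToRat n z i = z i := rfl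

lemma intToRat_injective (n : ℕ) : Function.Injective (intToRat n) := fun a b h => by
  funext i
  have := congrFun h i
  simpa using this

lemma exists_intToRat_eq_smul {n : ℕ} (x : Fin n → ℚ) :
    ∃ d : ℤ, d ≠ 0 ∧ ∃ z, intToRat n z = (d : ℚ) • x := by
  obtain ⟨b, hb⟩ := IsLocalization.exist_integer_multiples_of_finite (nonZeroDivisors ℤ) x
  choose z hz using hb
  refine ⟨b, nonZeroDivisors.coe_ne_zero b, z, ?_⟩
  funext i
  simpa using hz i

/-- The rank of a lattice is the dimension of its rational span. -/
lemma finrank_span_intToRat {n : ℕ} (Λ : Submodule ℤ (Fin n → ℤ)) :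
    Module.finrank ℚ (Submodule.span ℚ (intToRat n '' Λ)) = Module.finrank ℤ Λ := by
  let b := Module.finBasis ℤ Λ
  let w : Fin (Module.finrank ℤ Λ) → (Fin n → ℚ) := fun i => intToRat n (b i)
  have hw : LinearIndependent ℤ w :=
    b.linearIndependent.map' ((intToRat n).comp Λ.subtype)
      (LinearMap.ker_eq_bot.2 ((intToRat_injective n).comp Subtype.val_injective))
  have hw' : LinearIndependent ℚ w := (LinearIndependent.iff_fractionRing ℤ ℚ).1 hw
  have hspan : Submodule.span ℚ (intToRat n '' Λ) = Submodule.span ℚ (Set.range w) := by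
    apply le_antisymm
    · rw [Submodule.span_le]
      rintro _ ⟨z, hz, rfl⟩
      have h := congrArg (fun y : Λ => intToRat n y) (b.sum_repr ⟨z, hz⟩)
      simp only [Submodule.coe_sum, Submodule.coe_smul, map_sum, map_smul] at h
      rw [← h]
      refine Submodule.sum_mem _ fun i _ => ?_
      rw [← Int.cast_smul_eq_zsmul ℚ]
      exact Submodule.smul_mem _ _ (Submodule.subset_span ⟨i, rfl⟩)
    · refine Submodule.span_mono ?_
      rintro _ ⟨i, rfl⟩
      exact ⟨b i, (b i).2, rfl⟩
  rw [hspan, finrank_span_eq_card hw', Fintype.card_fin]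

/-- Evaluation of rational functionals at a real vector. -/
noncomputable def evalDual {n : ℕ} (v : Fin n → ℝ) : Module.Dual ℚ (Fin n → ℚ) →ₗ[ℚ] ℝ :=
  (Fintype.linearCombination ℚ v).comp
    ((Pi.basisFun ℚ (Fin n)).constr ℚ).symm.toLinearMap

lemma evalDual_apply {n : ℕ} (v : Fin n → ℝ) (φ : Module.Dual ℚ (Fin n → ℚ)) :
    evalDual v φ = ∑ i, (φ (Pi.single i 1) : ℝ) * v i := by
  have h : ((Pi.basisFun ℚ (Fin n)).constr ℚ).symm φ = fun i => φ (Pi.single i 1) := by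
    rw [LinearEquiv.symm_apply_eq]
    refine (Pi.basisFun ℚ (Fin n)).ext fun i => ?_
    rw [Module.Basis.constr_basis, Pi.basisFun_apply]
  simp [evalDual, h, Fintype.linearCombination_apply, Rat.smul_def]

lemma range_evalDual {n : ℕ} (v : Fin n → ℝ) :
    LinearMap.range (evalDual v) = Submodule.span ℚ (Set.range v) := by
  rw [evalDual, LinearMap.range_comp, LinearEquiv.range, Submodule.map_top,
    Fintype.range_linearCombination]

lemma dual_intToRat_apply {n : ℕ} (φ : Module.Dual ℚ (Fin n → ℚ)) (z : Fin n → ℤ) :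
    φ (intToRat n z) = ∑ i, φ (Pi.single i 1) * z i := by
  rw [LinearMap.pi_apply_eq_sum_univ φ (intToRat n z)]
  refine Finset.sum_congr rfl fun i _ => ?_
  rw [smul_eq_mul, mul_comm, intToRat_apply]
  congr 2
  funext j
  simp [Pi.single_apply, eq_comm]

lemma dimZ_add_finrank_ker {s : ℕ} (α : Fin s → ℝ) :
    dimZ α + Module.finrank ℚ (LinearMap.ker (evalDual (Fin.cons 1 α : Fin (s + 1) → ℝ)))
      = s + 1 := by
  have h := LinearMap.finrank_range_add_finrank_ker (evalDual (Fin.cons 1 α : Fin (s + 1) → ℝ))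
  rw [range_evalDual, Fin.range_cons, Subspace.dual_finrank_eq, Module.finrank_fin_fun] at h
  exact h

lemma abs_evalDual_sub_le {s : ℕ} (α : Fin s → ℝ) (φ : Module.Dual ℚ (Fin (s + 1) → ℚ))
    (z : Fin (s + 1) → ℤ) :
    |(z 0 : ℝ) * evalDual (Fin.cons 1 α : Fin (s + 1) → ℝ) φ - (φ (intToRat _ z) : ℚ)|
      ≤ (∑ i, |(φ (Pi.single i 1) : ℝ)|) * Derr α z := by
  rw [evalDual_apply, dual_intToRat_apply]
  push_cast
  rw [Finset.mul_sum, ← Finset.sum_sub_distrib, Finset.sum_mul]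
  refine (Finset.abs_sum_le_sum_abs _ _).trans (Finset.sum_le_sum fun i _ => ?_)
  have h : |(z 0 : ℝ) * (Fin.cons 1 α : Fin (s + 1) → ℝ) i - z i| ≤ Derr α z := by
    refine Fin.cases ?_ (fun j => ?_) i
    · simpa using Derr_nonneg α z
    · simpa using abs_coord_le_Derr α z j
  calc _ = |(φ (Pi.single i 1) : ℝ)| *
        |(z 0 : ℝ) * (Fin.cons 1 α : Fin (s + 1) → ℝ) i - z i| := by
        rw [← abs_mul]; congr 1; ring
    _ ≤ _ := by gcongr

/-- A rational relation between `1, α₁, …, α_s` is satisfied by late best approximations. -/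
lemma IsBSASeq.eventually_dual_eq_zero {s : ℕ} {α : Fin s → ℝ} (hα : α ≠ 0)
    {ζ : ℕ → Fin (s + 1) → ℤ} (hζ : IsBSASeq α ζ) {φ : Module.Dual ℚ (Fin (s + 1) → ℚ)}
    (hφ : evalDual (Fin.cons 1 α : Fin (s + 1) → ℝ) φ = 0) :
    ∀ᶠ ν in Filter.atTop, φ (intToRat _ (ζ ν)) = 0 := by
  obtain ⟨d, hd, c, hc⟩ := exists_intToRat_eq_smul fun i => φ (Pi.single i 1)
  set C : ℝ := ∑ i, |(φ (Pi.single i 1) : ℝ)| with hC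
  have hC0 : 0 ≤ C := Finset.sum_nonneg fun _ _ => abs_nonneg _
  have hd0 : 0 < |(d : ℝ)| := abs_pos.2 (by exact_mod_cast hd)
  have hpos : 0 < |(d : ℝ)| * (C + 1) := by positivity
  obtain ⟨P, hP⟩ := exists_Derr_lt_of_isBSA hα (inv_pos.2 hpos)
  filter_upwards [Filter.eventually_ge_atTop P.toNat] with ν hν
  have hD := hP (ζ ν) (hζ.1 ν) (by have := hζ.le_apply_zero ν; omega)
  have hle := abs_evalDual_sub_le α φ (ζ ν)
  rw [hφ, mul_zero, zero_sub, abs_neg, ← hC] at hle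
  have hmul : (d : ℚ) * φ (intToRat _ (ζ ν)) = ((∑ i, c i * ζ ν i : ℤ) : ℚ) := by
    rw [dual_intToRat_apply, Finset.mul_sum]
    push_cast
    refine Finset.sum_congr rfl fun i _ => ?_
    have := congrFun hc i
    simp only [intToRat_apply, Pi.smul_apply, smul_eq_mul] at this
    rw [this]
    ring
  have hlt : |(d : ℝ) * (φ (intToRat _ (ζ ν)) : ℚ)| < 1 := by
    rw [abs_mul]
    calc |(d : ℝ)| * |((φ (intToRat _ (ζ ν)) : ℚ) : ℝ)|
        ≤ |(d : ℝ)| * (C * Derr α (ζ ν)) := by gcongr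
      _ ≤ |(d : ℝ)| * ((C + 1) * Derr α (ζ ν)) := by
          have := Derr_nonneg α (ζ ν)
          gcongr
          linarith
      _ = (|(d : ℝ)| * (C + 1)) * Derr α (ζ ν) := by ring
      _ < (|(d : ℝ)| * (C + 1)) * (|(d : ℝ)| * (C + 1))⁻¹ := by gcongr
      _ = 1 := mul_inv_cancel₀ hpos.ne'
  have hlt' : |((∑ i, c i * ζ ν i : ℤ) : ℚ)| < 1 := by
    rw [← hmul]
    exact_mod_cast hlt
  have hzero : (∑ i, c i * ζ ν i : ℤ) = 0 := Int.abs_lt_one_iff.1 (by exact_mod_cast hlt')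
  rw [hzero, Int.cast_zero] at hmul
  exact (mul_eq_zero.1 hmul).resolve_left (by exact_mod_cast hd)

/-- A rational functional vanishing on late best approximations is a relation
between `1, α₁, …, α_s`. -/
lemma IsBSASeq.evalDual_eq_zero {s : ℕ} {α : Fin s → ℝ}
    {ζ : ℕ → Fin (s + 1) → ℤ} (hζ : IsBSASeq α ζ) {φ : Module.Dual ℚ (Fin (s + 1) → ℚ)}
    {ν₀ : ℕ} (hφ : ∀ ν > ν₀, φ (intToRat _ (ζ ν)) = 0) :
    evalDual (Fin.cons 1 α : Fin (s + 1) → ℝ) φ = 0 := by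
  by_contra hne
  set C : ℝ := ∑ i, |(φ (Pi.single i 1) : ℝ)| with hC
  have hC0 : 0 ≤ C := Finset.sum_nonneg fun _ _ => abs_nonneg _
  have hE := abs_pos.2 hne
  obtain ⟨N, hN⟩ := exists_nat_gt (C / |evalDual (Fin.cons 1 α : Fin (s + 1) → ℝ) φ|)
  rw [div_lt_iff₀ hE] at hN
  let ν := max N (ν₀ + 1)
  have hle := abs_evalDual_sub_le α φ (ζ ν)
  rw [hφ ν (lt_of_lt_of_le (Nat.lt_succ_self _) (le_max_right _ _)), Rat.cast_zero, sub_zero,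
    abs_mul, ← hC] at hle
  have h1 : (N : ℝ) ≤ |(ζ ν 0 : ℝ)| := by
    refine le_trans ?_ (le_abs_self _)
    have : (N : ℤ) ≤ ζ ν 0 :=
      le_trans (by exact_mod_cast le_max_left _ _) (hζ.le_apply_zero ν)
    exact_mod_cast this
  have h2 := mul_le_mul_of_nonneg_left (hζ.1 ν).Derr_le_half hC0
  have h3 := mul_le_mul_of_nonneg_right h1 hE.le
  linarith

lemma exists_lattice_finrank_eq_dimZ {s : ℕ} {α : Fin s → ℝ} (hα : α ≠ 0)
    {ζ : ℕ → Fin (s + 1) → ℤ} (hζ : IsBSASeq α ζ) :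
    ∃ Λ : Submodule ℤ (Fin (s + 1) → ℤ), Module.finrank ℤ Λ = dimZ α ∧
      ∃ ν₀ : ℕ, ∀ ν > ν₀, ζ ν ∈ Λ := by
  let K := LinearMap.ker (evalDual (Fin.cons 1 α : Fin (s + 1) → ℝ))
  let W := K.dualCoannihilator
  let Λ : Submodule ℤ (Fin (s + 1) → ℤ) := (W.restrictScalars ℤ).comap (intToRat (s + 1))
  refine ⟨Λ, ?_, ?_⟩
  · have hspan : Submodule.span ℚ (intToRat (s + 1) '' Λ) = W := by
      apply le_antisymm
      · rw [Submodule.span_le]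
        rintro _ ⟨z, hz, rfl⟩
        exact hz
      · intro x hx
        obtain ⟨d, hd, z, hz⟩ := exists_intToRat_eq_smul x
        have hd' : (d : ℚ) ≠ 0 := by exact_mod_cast hd
        have hzW : intToRat (s + 1) z ∈ W := hz ▸ W.smul_mem _ hx
        have hx' : x = (d : ℚ)⁻¹ • intToRat (s + 1) z := by
          rw [hz, smul_smul, inv_mul_cancel₀ hd', one_smul]
        rw [hx']
        exact Submodule.smul_mem _ _ (Submodule.subset_span ⟨z, hzW, rfl⟩)
    have h1 := finrank_span_intToRat Λ
    have h2 := Subspace.finrank_add_finrank_dualCoannihilator_eq K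
    have h3 := dimZ_add_finrank_ker α
    rw [hspan] at h1
    rw [Module.finrank_fin_fun] at h2
    change _ + Module.finrank ℚ W = _ at h2
    change _ + Module.finrank ℚ K = _ at h3
    omega
  · let b := Module.finBasis ℚ K
    have hev : ∀ᶠ ν in Filter.atTop, ∀ i,
        (b i : Module.Dual ℚ (Fin (s + 1) → ℚ)) (intToRat _ (ζ ν)) = 0 :=
      Filter.eventually_all.2 fun i => hζ.eventually_dual_eq_zero hα (b i).2
    obtain ⟨ν₀, hν₀⟩ := Filter.eventually_atTop.1 hev
    refine ⟨ν₀, fun ν hν => ?_⟩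
    change intToRat (s + 1) (ζ ν) ∈ K.dualCoannihilator
    rw [Submodule.mem_dualCoannihilator]
    intro φ hφ
    have h := congrArg (fun y : K => (y : Module.Dual ℚ (Fin (s + 1) → ℚ)) (intToRat _ (ζ ν)))
      (b.sum_repr ⟨φ, hφ⟩)
    simp only [Submodule.coe_sum, Submodule.coe_smul, LinearMap.sum_apply,
      LinearMap.smul_apply, hν₀ ν hν.le, smul_zero, Finset.sum_const_zero] at h
    exact h.symm

lemma dimZ_le_finrank {s : ℕ} {α : Fin s → ℝ} {ζ : ℕ → Fin (s + 1) → ℤ} (hζ : IsBSASeq α ζ)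
    (Λ : Submodule ℤ (Fin (s + 1) → ℤ)) {ν₀ : ℕ} (hΛ : ∀ ν > ν₀, ζ ν ∈ Λ) :
    dimZ α ≤ Module.finrank ℤ Λ := by
  let W := Submodule.span ℚ (intToRat (s + 1) '' Λ)
  have hle : W.dualAnnihilator ≤ LinearMap.ker (evalDual (Fin.cons 1 α : Fin (s + 1) → ℝ)) := by
    intro φ hφ
    rw [Submodule.mem_dualAnnihilator] at hφ
    exact hζ.evalDual_eq_zero fun ν hν =>
      hφ _ (Submodule.subset_span ⟨ζ ν, hΛ ν hν, rfl⟩)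
  have h1 := finrank_span_intToRat Λ
  have h2 := Subspace.finrank_add_finrank_dualAnnihilator_eq W
  have h3 := dimZ_add_finrank_ker α
  have h4 := Submodule.finrank_mono hle
  rw [Module.finrank_fin_fun] at h2
  change Module.finrank ℚ W = _ at h1
  omega

/-- For any `s ≥ 1` and `α ∉ ℚ^s`, the minimal rank of a sublattice of
`ℤ^{s+1}` containing all but finitely many b.s.a. to `α` equals `dim_ℤ α`. -/
theorem stmt5 (s : ℕ) (hs : 1 ≤ s) (α : Fin s → ℝ)
    (hα : ¬ ∀ j : Fin s, ∃ q : ℚ, (q : ℝ) = α j)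
    (ζ : ℕ → Fin (s + 1) → ℤ) (hζ : IsBSASeq α ζ) :
    IsLeast {n : ℕ | ∃ Λ : Submodule ℤ (Fin (s + 1) → ℤ), Module.finrank ℤ Λ = n ∧
      ∃ ν₀ : ℕ, ∀ ν > ν₀, ζ ν ∈ Λ} (dimZ α) := by
  have hα0 : α ≠ 0 := by
    rintro rfl
    exact hα fun j => ⟨0, by simp⟩
  refine ⟨exists_lattice_finrank_eq_dimZ hα0 hζ, ?_⟩
  rintro n ⟨Λ, rfl, ν₀, hΛ⟩
  exact dimZ_le_finrank hζ Λ hΛ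
end

section
/- Let s = 2 and let α₁, α₂ ∈ ℝ be such that 1, α₁, α₂ are linearly independent over ℚ. Then there exist infinitely many indices ν such that the 3×3 matrix M_ν[α], whose rows are the consecutive best simultaneous approximations ζ^ν, ζ^{ν+1}, ζ^{ν+2}, has rank 3; in particular det M_ν[α] ≠ 0 for infinitely many ν. -/
open scoped BigOperators

open Matrix

/-- A best simultaneous approximation has error at most `1 / 2`: rounding the coordinates of
`p α` already achieves this. -/
theorem IsBSA.derr_le_half {s : ℕ} {α : Fin s → ℝ} {ζ : Fin (s + 1) → ℤ} (h : IsBSA α ζ) :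
    Derr α ζ ≤ 1 / 2 := by
  by_contra! hlt
  set η : Fin (s + 1) → ℤ := Fin.cons (ζ 0) fun j => round ((ζ 0 : ℝ) * α j) with hη
  have hle : Derr α η ≤ 1 / 2 := by
    refine (pi_norm_le_iff_of_nonneg (by norm_num)).2 fun j => ?_
    simpa [hη] using abs_sub_round ((ζ 0 : ℝ) * α j)
  have hne : (fun j : Fin s => η j.succ) ≠ fun j : Fin s => ζ j.succ := by
    intro heq
    have : η = ζ := by
      funext i
      refine Fin.cases ?_ (fun j => ?_) i
      · simp [hη]
      · exact congrFun heq j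
    rw [this] at hle
    linarith
  have := h.2 η (by simpa [hη] using h.1) (by simp [hη]) hne
  linarith

theorem abs_sub_le_derr {s : ℕ} (α : Fin s → ℝ) (ζ : Fin (s + 1) → ℤ) (j : Fin s) :
    |(ζ 0 : ℝ) * α j - ζ j.succ| ≤ Derr α ζ :=
  norm_le_pi_norm (fun j : Fin s => (ζ 0 : ℝ) * α j - (ζ j.succ : ℝ)) j

/-- Two best simultaneous approximations with different denominators are not proportional, as soon
as the smaller one has a nonzero numerator. -/
theorem IsBSA.not_proportional {s : ℕ} {α : Fin s → ℝ} {ζ ξ : Fin (s + 1) → ℤ}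
    (hζ : IsBSA α ζ) (hξ : IsBSA α ξ) (hlt : ζ 0 < ξ 0) {j₀ : Fin s} (hj₀ : ζ j₀.succ ≠ 0) :
    ¬ ∀ j : Fin s, ζ 0 * ξ j.succ = ξ 0 * ζ j.succ := by
  intro hpar
  have hne : (fun j : Fin s => ζ j.succ) ≠ fun j : Fin s => ξ j.succ := by
    intro heq
    have h1 := hpar j₀
    rw [← congrFun heq j₀] at h1
    exact hlt.ne (mul_right_cancel₀ hj₀ h1)
  have hD := hξ.2 ζ hζ.1 hlt.le hne
  have hpos : (0 : ℝ) < ζ 0 := by exact_mod_cast hζ.1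
  have hltR : (ζ 0 : ℝ) < ξ 0 := by exact_mod_cast hlt
  have hscale : (ζ 0 : ℝ) * Derr α ξ = ξ 0 * Derr α ζ := by
    have hvec : (ζ 0 : ℝ) • (fun j : Fin s => (ξ 0 : ℝ) * α j - (ξ j.succ : ℝ)) =
        (ξ 0 : ℝ) • fun j : Fin s => (ζ 0 : ℝ) * α j - (ζ j.succ : ℝ) := by
      funext j
      have h2 : (ζ 0 : ℝ) * ξ j.succ = ξ 0 * ζ j.succ := by exact_mod_cast hpar j
      simp only [Pi.smul_apply, smul_eq_mul]
      linear_combination -h2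
    have hnorm := congrArg norm hvec
    rwa [norm_smul, norm_smul, Real.norm_of_nonneg hpos.le,
      Real.norm_of_nonneg (hpos.trans hltR).le] at hnorm
  have hD0 : 0 ≤ Derr α ζ := norm_nonneg _
  nlinarith

/-- If `x`, `y`, `z` are coplanar and `x`, `y` are not proportional, then a linear form vanishing at
`x` and `y` vanishes at `z`. -/
theorem dotProduct_eq_zero_of_det_eq_zero_s6 {n x y z : Fin 3 → ℤ}
    (hxy : x ⨯₃ y ≠ 0) (hdet : (x ⨯₃ y) ⬝ᵥ z = 0) (hx : n ⬝ᵥ x = 0) (hy : n ⬝ᵥ y = 0) :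
    n ⬝ᵥ z = 0 := by
  by_contra hz
  apply hxy
  simp only [cross_apply, dotProduct, Fin.sum_univ_three, Matrix.cons_val] at *
  funext k
  refine mul_right_cancel₀ hz ?_
  fin_cases k
  · simp only [Fin.zero_eta, Matrix.cons_val, Pi.zero_apply, zero_mul]
    linear_combination n 0 * hdet + (y 2 * z 1 - y 1 * z 2) * hx + (x 1 * z 2 - x 2 * z 1) * hy
  · simp only [Fin.mk_one, Matrix.cons_val, Pi.zero_apply, zero_mul]
    linear_combination n 1 * hdet + (y 0 * z 2 - y 2 * z 0) * hx + (x 2 * z 0 - x 0 * z 2) * hy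
  · simp only [Fin.reduceFinMk, Matrix.cons_val, Pi.zero_apply, zero_mul]
    linear_combination n 2 * hdet + (y 1 * z 0 - y 0 * z 1) * hx + (x 0 * z 1 - x 1 * z 0) * hy

/-- For `s = 2` and `1, α₁, α₂` linearly independent over `ℚ`, for
infinitely many `ν` the matrix `M_ν[α]` with rows `ζ^ν, ζ^{ν+1}, ζ^{ν+2}` has rank `3`;
in particular its determinant is nonzero. -/
theorem stmt6 (α : Fin 2 → ℝ)
    (hα : ∀ c : Fin 3 → ℤ, ((c 0 : ℝ) + ∑ j : Fin 2, (c j.succ : ℝ) * α j = 0) → c = 0)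
    (ζ : ℕ → Fin 3 → ℤ) (hζ : IsBSASeq α ζ) :
    {ν : ℕ | (Matrix.of fun i j : Fin 3 => ζ (ν + (i : ℕ)) j).rank = 3 ∧
      Matrix.det (Matrix.of fun i j : Fin 3 => ζ (ν + (i : ℕ)) j) ≠ 0}.Infinite := by
  have hBSA := hζ.1
  have hgrow : ∀ ν : ℕ, (ν : ℤ) + 1 ≤ ζ ν 0 := by
    intro ν
    induction ν with
    | zero => simpa using (hBSA 0).1
    | succ k ih => have := hζ.2.1 k; push_cast; omega
  have hα0 : α 0 ≠ 0 := by
    intro h0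
    have := congrFun (hα ![0, 1, 0] (by simp [Fin.sum_univ_two, h0])) 1
    simp at this
  obtain ⟨K, hK⟩ := exists_nat_gt (1 / |α 0|)
  have hα0' : 0 < |α 0| := abs_pos.2 hα0
  have hnum : ∀ ν ≥ K, ζ ν (0 : Fin 2).succ ≠ 0 := by
    intro ν hν h0
    have h1 := (abs_sub_le_derr α (ζ ν) 0).trans (hBSA ν).derr_le_half
    have h2 : ((ν : ℝ) + 1) ≤ ζ ν 0 := by exact_mod_cast hgrow ν
    have h3 : (K : ℝ) ≤ ν := by exact_mod_cast hν
    rw [div_lt_iff₀ hα0'] at hK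
    rw [h0, Int.cast_zero, sub_zero, abs_mul] at h1
    have h4 := le_abs_self (ζ ν 0 : ℝ)
    nlinarith
  have hcross : ∀ ν ≥ K, ζ ν ⨯₃ ζ (ν + 1) ≠ 0 := by
    intro ν hν h0
    refine (hBSA ν).not_proportional (hBSA (ν + 1)) (hζ.2.1 ν) (hnum ν hν) fun j => ?_
    have h1 := congrFun h0 1
    have h2 := congrFun h0 2
    simp only [cross_apply, Matrix.cons_val, Pi.zero_apply] at h1 h2
    fin_cases j
    · simp
      linear_combination h2
    · simp
      linear_combination -h1
  by_contra hfin
  obtain ⟨B, hB⟩ := (Set.not_infinite.1 hfin).bddAbove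
  have hdet : ∀ ν > B, (ζ ν ⨯₃ ζ (ν + 1)) ⬝ᵥ ζ (ν + 2) = 0 := by
    intro ν hν
    by_contra hne
    refine hν.not_ge (hB ?_)
    have hd : Matrix.det (Matrix.of fun i j : Fin 3 => ζ (ν + (i : ℕ)) j) ≠ 0 := by
      convert hne using 1
      simp [Matrix.det_fin_three, cross_apply, dotProduct, Fin.sum_univ_three]
      ring
    exact ⟨by simpa using Matrix.rank_of_det_ne_zero hd, hd⟩
  set N := max K (B + 1) with hN
  set n := ζ N ⨯₃ ζ (N + 1) with hn
  have hplane : ∀ k : ℕ, n ⬝ᵥ ζ (N + k) = 0 ∧ n ⬝ᵥ ζ (N + k + 1) = 0 := by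
    intro k
    induction k with
    | zero =>
      constructor
      · rw [dotProduct_comm]; exact dot_self_cross _ _
      · rw [dotProduct_comm]; exact dot_cross_self _ _
    | succ k ih =>
      exact ⟨ih.2, dotProduct_eq_zero_of_det_eq_zero_s6 (hcross (N + k) (by omega))
        (hdet (N + k) (by omega)) ih.1 ih.2⟩
  refine hcross N (by omega) (hα n ?_)
  by_contra hL
  set L : ℝ := (n 0 : ℝ) + ∑ j : Fin 2, (n j.succ : ℝ) * α j with hLdef
  obtain ⟨k, hk⟩ := exists_nat_gt ((|(n 1 : ℝ)| + |(n 2 : ℝ)|) / |L|)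
  rw [div_lt_iff₀ (abs_pos.2 hL)] at hk
  have hz : (n 0 : ℝ) * ζ (N + k) 0 + n 1 * ζ (N + k) 1 + n 2 * ζ (N + k) 2 = 0 := by
    have := (hplane k).1
    simp only [dotProduct, Fin.sum_univ_three] at this
    exact_mod_cast this
  have herr : ∀ j : Fin 2, |(ζ (N + k) 0 : ℝ) * α j - ζ (N + k) j.succ| ≤ 1 := fun j =>
    ((abs_sub_le_derr α _ j).trans (hBSA _).derr_le_half).trans (by norm_num)
  have hp : (k : ℝ) ≤ ζ (N + k) 0 := by
    have : (k : ℤ) ≤ ζ (N + k) 0 := by have := hgrow (N + k); push_cast at this; omega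
    exact_mod_cast this
  have hLp : (ζ (N + k) 0 : ℝ) * L = n 1 * ((ζ (N + k) 0 : ℝ) * α 0 - ζ (N + k) 1) +
      n 2 * ((ζ (N + k) 0 : ℝ) * α 1 - ζ (N + k) 2) := by
    simp only [hLdef, Fin.sum_univ_two, Fin.succ_zero_eq_one, Fin.succ_one_eq_two]
    linear_combination hz
  have hbound : |(ζ (N + k) 0 : ℝ) * L| ≤ |(n 1 : ℝ)| + |(n 2 : ℝ)| := by
    rw [hLp]
    refine (abs_add_le _ _).trans ?_
    rw [abs_mul, abs_mul]
    exact add_le_add (mul_le_of_le_one_right (abs_nonneg _) (herr 0))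
      (mul_le_of_le_one_right (abs_nonneg _) (herr 1))
  rw [abs_mul] at hbound
  have h4 := le_abs_self (ζ (N + k) 0 : ℝ)
  have h5 := mul_le_mul_of_nonneg_right (hp.trans h4) (abs_nonneg L)
  linarith
end

section
/- Let s ≥ 3. Then there exists an uncountable set of s-tuples α = (α₁,…,α_s) ∈ ℝ^s, each with 1, α₁, …, α_s linearly independent over ℚ, such that for every ν ∈ ℕ the (s+1)×(s+1) matrix M_ν[α], whose rows are the consecutive best simultaneous approximations ζ^ν, …, ζ^{ν+s}, has rank at most 3; in particular det M_ν[α] = 0 for all ν. -/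
open scoped BigOperators

/-- The denominators `q₀ = 1`, `q_{n+1} = 16 q_n²` of the rational points approximating `α`. -/
def den : ℕ → ℤ
  | 0 => 1
  | n + 1 => 16 * den n ^ 2

/-- The numerators of the rational points approximating `α`: the point of index `n + 1` differs
from the point of index `n` by `d n / den (n + 1)` in the coordinate direction `i n`. -/
def num {s : ℕ} (i : ℕ → Fin s) (d : ℕ → ℤ) : ℕ → Fin s → ℤ
  | 0 => fun _ => 2
  | n + 1 => fun j => 16 * den n * num i d n j + if j = i n then d n else 0

/-- The integer point `(den n, num n)`. -/
def vertex {s : ℕ} (i : ℕ → Fin s) (d : ℕ → ℤ) (n : ℕ) : Fin (s + 1) → ℤ :=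
  Fin.cons (den n) (num i d n)

/-- The coordinate directions: each one is kept for `s + 1` consecutive steps, and all of them
are visited cyclically. -/
def direction {s : ℕ} (hs : 0 < s) (n : ℕ) : Fin s :=
  ⟨n / (s + 1) % s, Nat.mod_lt _ hs⟩

lemma den_pos (n : ℕ) : 0 < den n := by
  induction n with
  | zero => simp [den]
  | succ n ih => simp only [den]; positivity

lemma den_lt_succ (n : ℕ) : den n < den (n + 1) := by
  have := den_pos n
  simp only [den]; nlinarith

lemma den_strictMono : StrictMono den := strictMono_nat_of_lt_succ den_lt_succ

lemma lt_den (n : ℕ) : (n : ℤ) < den n := by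
  induction n with
  | zero => simp [den]
  | succ n ih =>
    have := den_lt_succ n
    push_cast; linarith

lemma one_le_den (n : ℕ) : (1 : ℝ) ≤ den n := by
  exact_mod_cast den_pos n

lemma den_succ_real (n : ℕ) : (den (n + 1) : ℝ) = 16 * (den n : ℝ) ^ 2 := by
  simp [den]

section

variable {s : ℕ} {i : ℕ → Fin s} {d : ℕ → ℤ}

lemma num_succ_of_ne {n : ℕ} {j : Fin s} (h : j ≠ i n) :
    den n * num i d (n + 1) j = den (n + 1) * num i d n j := by
  simp only [num, den, if_neg h]; ring

lemma num_add_of_ne {n t : ℕ} {j : Fin s} (h : ∀ u < t, i (n + u) ≠ j) :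
    den n * num i d (n + t) j = den (n + t) * num i d n j := by
  induction t with
  | zero => simp
  | succ t ih =>
    have h1 := ih fun u hu => h u (by omega)
    have h2 := num_succ_of_ne (d := d) (h t (by omega)).symm
    have h3 := (den_pos (n + t)).ne'
    apply mul_left_cancel₀ h3
    rw [← add_assoc]
    linear_combination den n * h2 + den (n + t + 1) * h1

lemma den_dvd_of_forall_dvd (hd : ∀ n, d n * d n = 1) (n : ℕ) {p : ℤ}
    (h : ∀ j, den n ∣ p * num i d n j) : den n ∣ p := by
  cases n with
  | zero => simp [den]
  | succ n =>
    have h1 := h (i n)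
    have h2 : IsCoprime (den (n + 1)) (num i d (n + 1) (i n)) := by
      have h3 : IsCoprime (16 * den n) (num i d (n + 1) (i n)) := by
        refine ⟨-(d n * num i d n (i n)), d n, ?_⟩
        simp only [num, if_true]
        linear_combination hd n
      have h4 : den (n + 1) = (16 * den n) * den n := by simp only [den]; ring
      rw [h4]
      exact h3.mul_left h3.of_mul_left_right
    exact h2.dvd_of_dvd_mul_right h1

lemma exists_forall_abs_le (hd : ∀ n, d n * d n = 1) :
    ∃ α : Fin s → ℝ, ∀ n j, |(den n : ℝ) * α j - num i d n j| ≤ 1 / (8 * den n) := by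
  have hd1 : ∀ n, |(d n : ℝ)| ≤ 1 := fun n => by
    rcases mul_self_eq_one_iff.1 (hd n) with h | h <;> simp [h]
  set r : Fin s → ℕ → ℝ := fun j n => (num i d n j : ℝ) / den n with hr
  have hstep : ∀ j n, |r j (n + 1) - r j n| ≤ 1 / den (n + 1) := by
    intro j n
    have h1 := one_le_den n
    have h2 := one_le_den (n + 1)
    have : r j (n + 1) - r j n = (if j = i n then (d n : ℝ) else 0) / den (n + 1) := by
      simp only [hr, num]
      rw [den_succ_real]
      split_ifs <;> push_cast <;> field_simp <;> ring
    rw [this, abs_div, abs_of_pos (by linarith : (0 : ℝ) < den (n + 1))]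
    gcongr
    split_ifs
    · exact hd1 n
    · simp
  have hbound : ∀ j n t, |r j (n + t) - r j n| ≤ 2 / den (n + 1) - 2 / den (n + t + 1) := by
    intro j n t
    induction t with
    | zero => simp
    | succ t ih =>
      have h1 := hstep j (n + t)
      have h2 := one_le_den (n + t + 1)
      have h3 : (2 : ℝ) / den (n + t + 1 + 1) ≤ 1 / den (n + t + 1) := by
        rw [den_succ_real, div_le_div_iff₀ (by positivity) (by linarith)]
        nlinarith
      have h4 := abs_sub_le (r j (n + t + 1)) (r j (n + t)) (r j n)
      have h5 : (2 : ℝ) / den (n + t + 1) = 2 * (1 / den (n + t + 1)) := by ring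
      rw [← add_assoc]
      linarith
  have hpow : ∀ n, (2 : ℝ) ^ n ≤ den (n + 1) := by
    intro n
    induction n with
    | zero => simpa using one_le_den 1
    | succ n ih =>
      have := one_le_den (n + 1)
      rw [den_succ_real (n + 1), pow_succ]
      nlinarith
  have hlim : ∀ j, ∃ a, Filter.Tendsto (r j) Filter.atTop (nhds a) := by
    intro j
    apply cauchySeq_tendsto_of_complete
    refine cauchySeq_of_le_geometric (1 / 2) 1 (by norm_num) fun n => ?_
    rw [dist_comm, Real.dist_eq]
    refine (hstep j n).trans ?_
    rw [one_mul, one_div_pow]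
    exact one_div_le_one_div_of_le (by positivity) (hpow n)
  choose α hα using hlim
  refine ⟨α, fun n j => ?_⟩
  have h1 := one_le_den n
  have h2 : |α j - r j n| ≤ 2 / den (n + 1) := by
    refine le_of_tendsto (((hα j).sub_const (r j n)).abs) ?_
    filter_upwards [Filter.eventually_ge_atTop n] with m hm
    obtain ⟨t, rfl⟩ := Nat.exists_eq_add_of_le hm
    have := one_le_den (n + t + 1)
    have h3 : (0 : ℝ) ≤ 2 / den (n + t + 1) := by positivity
    linarith [hbound j n t]
  have h3 : (den n : ℝ) * α j - num i d n j = den n * (α j - r j n) := by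
    simp only [hr]; field_simp
  rw [h3, abs_mul, abs_of_pos (by linarith : (0 : ℝ) < den n)]
  calc (den n : ℝ) * |α j - r j n| ≤ den n * (2 / den (n + 1)) := by gcongr
    _ = 1 / (8 * den n) := by rw [den_succ_real]; field_simp; norm_num

variable {α : Fin s → ℝ}

lemma abs_le_Derr (ζ : Fin (s + 1) → ℤ) (j : Fin s) :
    |(ζ 0 : ℝ) * α j - ζ j.succ| ≤ Derr α ζ :=
  norm_le_pi_norm (fun j : Fin s => (ζ 0 : ℝ) * α j - (ζ j.succ : ℝ)) j

lemma Derr_le {ζ : Fin (s + 1) → ℤ} {b : ℝ} (hb : 0 ≤ b)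
    (h : ∀ j : Fin s, |(ζ 0 : ℝ) * α j - ζ j.succ| ≤ b) : Derr α ζ ≤ b :=
  (pi_norm_le_iff_of_nonneg hb).2 h

lemma IsBSA.eq_of_zero_eq {ζ η : Fin (s + 1) → ℤ} (hζ : IsBSA α ζ) (hη : IsBSA α η)
    (h : ζ 0 = η 0) : ζ = η := by
  by_contra hne
  have hne' : (fun j : Fin s => η j.succ) ≠ fun j : Fin s => ζ j.succ := by
    intro h'
    apply hne
    funext k
    refine Fin.cases h (fun j => ?_) k
    exact (congrFun h' j).symm
  have h1 := hζ.2 η hη.1 h.ge hne'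
  have h2 := hη.2 ζ hζ.1 h.le hne'.symm
  exact lt_asymm h1 h2

lemma Derr_vertex_le (hα : ∀ n j, |(den n : ℝ) * α j - num i d n j| ≤ 1 / (8 * den n)) (n : ℕ) :
    Derr α (vertex i d n) ≤ 1 / (8 * den n) := by
  have := one_le_den n
  exact Derr_le (by positivity) fun j => by simpa [vertex] using hα n j

lemma isBSA_vertex (hd : ∀ n, d n * d n = 1)
    (hα : ∀ n j, |(den n : ℝ) * α j - num i d n j| ≤ 1 / (8 * den n)) (n : ℕ) :
    IsBSA α (vertex i d n) := by
  refine ⟨by simpa [vertex] using Int.add_one_le_of_lt (den_pos n), fun η h1 h2 hne => ?_⟩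
  replace h2 : η 0 ≤ den n := by simpa [vertex] using h2
  obtain ⟨j, hj⟩ : ∃ j : Fin s, η 0 * num i d n j ≠ den n * η j.succ := by
    by_contra! hall
    have h3 : den n ∣ η 0 := den_dvd_of_forall_dvd hd n fun j => ⟨_, hall j⟩
    have h4 : η 0 = den n := le_antisymm h2 (Int.le_of_dvd (by linarith) h3)
    apply hne
    funext j
    have h5 := hall j
    rw [h4] at h5
    simpa [vertex] using (mul_left_cancel₀ (den_pos n).ne' h5).symm
  refine (Derr_vertex_le hα n).trans_lt (lt_of_lt_of_le ?_ (abs_le_Derr η j))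
  have hq := one_le_den n
  have h6 : (1 : ℝ) ≤ |(η 0 : ℝ) * num i d n j - den n * η j.succ| := by
    exact_mod_cast Int.one_le_abs (sub_ne_zero.2 hj)
  have h7 : (1 : ℝ) ≤ η 0 := by exact_mod_cast h1
  have h8 : (η 0 : ℝ) ≤ den n := by exact_mod_cast h2
  have h9 : (η 0 : ℝ) * num i d n j - den n * η j.succ =
      den n * (η 0 * α j - η j.succ) - η 0 * (den n * α j - num i d n j) := by ring
  have h10 : |(η 0 : ℝ) * (den n * α j - num i d n j)| ≤ 1 / 8 := by
    rw [abs_mul, abs_of_pos (by linarith : (0 : ℝ) < η 0)]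
    calc (η 0 : ℝ) * |(den n : ℝ) * α j - num i d n j| ≤ den n * (1 / (8 * den n)) :=
          mul_le_mul h8 (hα n j) (abs_nonneg _) (by linarith)
      _ = 1 / 8 := by field_simp
  have h11 : 7 / 8 ≤ (den n : ℝ) * |(η 0 : ℝ) * α j - η j.succ| := by
    have h12 : |(den n : ℝ) * (η 0 * α j - η j.succ)| = den n * |(η 0 : ℝ) * α j - η j.succ| := by
      rw [abs_mul, abs_of_pos (by linarith : (0 : ℝ) < den n)]
    have := abs_sub ((den n : ℝ) * (η 0 * α j - η j.succ)) (η 0 * (den n * α j - num i d n j))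
    rw [h9] at h6
    rw [h12] at this
    linarith
  rw [div_lt_iff₀ (by linarith)]
  linarith

lemma IsBSA.succ_ne_num
    (hα : ∀ n j, |(den n : ℝ) * α j - num i d n j| ≤ 1 / (8 * den n)) {n : ℕ}
    {η : Fin (s + 1) → ℤ} (hη : IsBSA α η) (h : den n < η 0) :
    (fun j : Fin s => η j.succ) ≠ num i d n := by
  intro heq
  have hbig : ∀ j : Fin s, 1 ≤ (η 0 : ℝ) * α j - η j.succ := by
    intro j
    have h0 := abs_le.1 (hα 0 j)
    have h1 := abs_le.1 (hα n j)
    have hq := one_le_den n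
    have h2 : (1 : ℝ) / (8 * den n) ≤ 1 / 8 := by
      apply one_div_le_one_div_of_le <;> linarith
    have h3 : (den n : ℝ) + 1 ≤ η 0 := by exact_mod_cast h
    have h4 : η j.succ = num i d n j := congrFun heq j
    simp only [den, num] at h0
    norm_num at h0
    rw [h4]
    nlinarith
  have hlt := hη.2 (Fin.cons (η 0) fun j => η j.succ + 1) (by simpa using hη.1) (by simp) (by
    intro h'
    have := congrFun h' (i 0)
    simp only [Fin.cons_succ] at this
    omega)
  refine hlt.not_ge (Derr_le (norm_nonneg _) fun j => le_trans ?_ (abs_le_Derr η j))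
  have := hbig j
  simp only [Fin.cons_zero, Fin.cons_succ, Int.cast_add, Int.cast_one]
  rw [abs_of_nonneg (by linarith), abs_of_nonneg (by linarith)]
  linarith

lemma IsBSA.eq_of_le_den_succ (hd : ∀ n, d n * d n = 1)
    (hα : ∀ n j, |(den n : ℝ) * α j - num i d n j| ≤ 1 / (8 * den n)) {n : ℕ}
    {η : Fin (s + 1) → ℤ} (hη : IsBSA α η) (h1 : den n ≤ η 0) (h2 : η 0 ≤ den (n + 1))
    {j : Fin s} (hj : i n ≠ j) : den n * η j.succ = η 0 * num i d n j := by
  rcases h1.eq_or_lt with h1 | h1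
  · rw [← (isBSA_vertex hd hα n).eq_of_zero_eq hη (by simpa [vertex] using h1)]
    simp [vertex]
  have hne := hη.succ_ne_num hα h1
  have hv := hη.2 (vertex i d n) (by simpa [vertex] using Int.add_one_le_of_lt (den_pos n))
    (by simpa [vertex] using h1.le) (by simpa [vertex] using hne.symm)
  have h3 := ((abs_le_Derr η j).trans_lt hv).trans_le (Derr_vertex_le hα n)
  have hq := one_le_den n
  have hq' := one_le_den (n + 1)
  have hlt : (den n : ℝ) < den (n + 1) := by exact_mod_cast den_lt_succ n
  have hp : (0 : ℝ) < η 0 := by exact_mod_cast hη.1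
  have hp' : (η 0 : ℝ) ≤ den (n + 1) := by exact_mod_cast h2
  have h4 : (den n : ℝ) * num i d (n + 1) j = den (n + 1) * num i d n j := by
    exact_mod_cast num_succ_of_ne hj.symm
  have h5 : (η 0 : ℝ) * num i d n j - den n * η j.succ =
      den n * (η 0 * α j - η j.succ) -
        den n * (η 0 / den (n + 1)) * (den (n + 1) * α j - num i d (n + 1) j) := by
    field_simp
    linear_combination (-(η 0 : ℝ)) * h4
  have h6 : |(den n : ℝ) * (η 0 * α j - η j.succ)| ≤ 1 / 8 := by
    rw [abs_mul, abs_of_pos (by linarith : (0 : ℝ) < den n)]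
    calc (den n : ℝ) * |(η 0 : ℝ) * α j - η j.succ| ≤ den n * (1 / (8 * den n)) := by gcongr
      _ = 1 / 8 := by field_simp
  have h7 : |(den n : ℝ) * (η 0 / den (n + 1)) * (den (n + 1) * α j - num i d (n + 1) j)|
      ≤ 1 / 8 := by
    rw [abs_mul, abs_of_pos (by positivity : (0 : ℝ) < den n * (η 0 / den (n + 1)))]
    calc (den n : ℝ) * (η 0 / den (n + 1)) * |(den (n + 1) : ℝ) * α j - num i d (n + 1) j|
        ≤ den (n + 1) * 1 * (1 / (8 * den (n + 1))) := by
          gcongr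
          · exact (div_le_one (by linarith)).2 hp'
          · exact hα (n + 1) j
      _ = 1 / 8 := by field_simp
  have h8 : |(η 0 : ℝ) * num i d n j - den n * η j.succ| < 1 := by
    rw [h5]
    refine (abs_sub _ _).trans_lt ?_
    linarith
  have h9 : |η 0 * num i d n j - den n * η j.succ| < 1 := by exact_mod_cast h8
  linarith [Int.abs_lt_one_iff.1 h9]

lemma IsBSA.eq_of_le_den_add (hd : ∀ n, d n * d n = 1)
    (hα : ∀ n j, |(den n : ℝ) * α j - num i d n j| ≤ 1 / (8 * den n)) {n t : ℕ}
    {η : Fin (s + 1) → ℤ} (hη : IsBSA α η) (h1 : den n ≤ η 0) (h2 : η 0 ≤ den (n + t + 1))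
    {j : Fin s} (hj : ∀ u ≤ t, i (n + u) ≠ j) : den n * η j.succ = η 0 * num i d n j := by
  induction t with
  | zero => exact hη.eq_of_le_den_succ hd hα h1 h2 (hj 0 le_rfl)
  | succ t ih =>
    rcases le_total (η 0) (den (n + t + 1)) with h | h
    · exact ih h fun u hu => hj u (by omega)
    · have h3 := hη.eq_of_le_den_succ hd hα h h2 (hj (t + 1) le_rfl)
      have h4 := num_add_of_ne (d := d) (n := n) (t := t + 1) fun u hu => hj u (by omega)
      rw [← add_assoc] at h4
      apply mul_left_cancel₀ (den_pos (n + t + 1)).ne'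
      linear_combination den n * h3 + η 0 * h4

lemma eq_zero_of_add_sum_eq_zero (hd : ∀ n, d n * d n = 1)
    (hi : ∀ j N, ∃ n, N ≤ n ∧ i n = j)
    (hα : ∀ n j, |(den n : ℝ) * α j - num i d n j| ≤ 1 / (8 * den n)) (c : Fin (s + 1) → ℤ)
    (hc : (c 0 : ℝ) + ∑ j : Fin s, (c j.succ : ℝ) * α j = 0) : c = 0 := by
  set T : ℕ → ℤ := fun n => c 0 * den n + ∑ j : Fin s, c j.succ * num i d n j with hT
  have hTsucc : ∀ n, T (n + 1) = 16 * den n * T n + c (i n).succ * d n := by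
    intro n
    simp only [hT, num, den, mul_add, Finset.sum_add_distrib, mul_ite, mul_zero,
      Finset.sum_ite_eq', Finset.mem_univ, if_true, Finset.mul_sum, ← add_assoc]
    congr 2
    · ring
    · exact Finset.sum_congr rfl fun j _ => by ring
  have hTzero : ∀ n : ℕ, ∑ j : Fin s, |c j.succ| ≤ n → T n = 0 := by
    intro n hn
    have hq := one_le_den n
    have h1 : (T n : ℝ) = ∑ j : Fin s, (c j.succ : ℝ) * (num i d n j - den n * α j) := by
      simp only [hT, mul_sub, Finset.sum_sub_distrib]
      push_cast
      have : ∑ j : Fin s, (c j.succ : ℝ) * (den n * α j)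
          = den n * ∑ j : Fin s, (c j.succ : ℝ) * α j := by
        rw [Finset.mul_sum]
        exact Finset.sum_congr rfl fun j _ => by ring
      rw [this]
      linear_combination (den n : ℝ) * hc
    have h2 : |(T n : ℝ)| ≤ (∑ j : Fin s, |(c j.succ : ℝ)|) * (1 / (8 * den n)) := by
      rw [h1, Finset.sum_mul]
      refine (Finset.abs_sum_le_sum_abs _ _).trans (Finset.sum_le_sum fun j _ => ?_)
      rw [abs_mul, abs_sub_comm]
      exact mul_le_mul_of_nonneg_left (hα n j) (abs_nonneg _)
    have h3 : (∑ j : Fin s, |(c j.succ : ℝ)|) ≤ den n := by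
      exact_mod_cast hn.trans (lt_den n).le
    have h4 : |(T n : ℝ)| < 1 := by
      calc |(T n : ℝ)| ≤ den n * (1 / (8 * den n)) := h2.trans (by gcongr)
        _ = 1 / 8 := by field_simp
        _ < 1 := by norm_num
    exact Int.abs_lt_one_iff.1 (by exact_mod_cast h4)
  have hcs : ∀ j : Fin s, c j.succ = 0 := by
    intro j
    obtain ⟨n, hn, rfl⟩ := hi j (∑ j : Fin s, |c j.succ|).toNat
    have h1 : ∑ j : Fin s, |c j.succ| ≤ n := by omega
    have h2 := hTsucc n
    rw [hTzero n h1, hTzero (n + 1) (by push_cast; linarith)] at h2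
    linear_combination (-(d n)) * h2 - c (i n).succ * hd n
  funext k
  refine Fin.cases ?_ hcs k
  simpa [hcs] using hc

lemma eq_of_forall_abs_le {d' : ℕ → ℤ}
    (hα : ∀ n j, |(den n : ℝ) * α j - num i d n j| ≤ 1 / (8 * den n))
    (hα' : ∀ n j, |(den n : ℝ) * α j - num i d' n j| ≤ 1 / (8 * den n)) : d = d' := by
  have h : ∀ n j, num i d n j = num i d' n j := by
    intro n j
    have hq := one_le_den n
    have h2 : (1 : ℝ) / (8 * den n) ≤ 1 / 8 := by
      apply one_div_le_one_div_of_le <;> linarith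
    have h3 := abs_le.1 (hα n j)
    have h4 := abs_le.1 (hα' n j)
    have h5 : |(num i d n j : ℝ) - num i d' n j| < 1 := by
      rw [abs_lt]; constructor <;> linarith
    have h6 : |num i d n j - num i d' n j| < 1 := by exact_mod_cast h5
    linarith [Int.abs_lt_one_iff.1 h6]
  funext n
  have h1 := h (n + 1) (i n)
  simpa only [num, if_true, h n (i n), add_right_inj] using h1

end

lemma rank_le_three_of_forall_eq {m s : ℕ} (M : Matrix (Fin m) (Fin (s + 1)) ℤ) {q : ℤ}
    (hq : q ≠ 0) (z : Fin s → ℤ) (x y : Fin s)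
    (h : ∀ a k, k ≠ x → k ≠ y → q * M a k.succ = M a 0 * z k) : M.rank ≤ 3 := by
  let A : Matrix (Fin m) (Fin 3) ℤ := Matrix.of fun a => ![M a 0, M a x.succ, M a y.succ]
  let B : Matrix (Fin 3) (Fin (s + 1)) ℤ := Matrix.of fun b k =>
    Fin.cases (![q, 0, 0] b)
      (fun j => if j = x then ![0, q, 0] b else if j = y then ![0, 0, q] b else ![z j, 0, 0] b) k
  have hAB : q • M = A * B := by
    ext a k
    refine Fin.cases ?_ (fun j => ?_) k
    · simp [A, B, Matrix.mul_apply, Fin.sum_univ_three, mul_comm]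
    · by_cases hx : j = x
      · simp [A, B, Matrix.mul_apply, Fin.sum_univ_three, hx, mul_comm]
      · by_cases hy : j = y
        · subst hy
          simp [A, B, Matrix.mul_apply, Fin.sum_univ_three, hx, mul_comm]
        · simp [A, B, Matrix.mul_apply, Fin.sum_univ_three, hx, hy, h a j hx hy]
  rw [← Matrix.rank_smul_of_mem_nonZeroDivisors M (mem_nonZeroDivisors_of_ne_zero hq), hAB]
  exact (Matrix.rank_mul_le_left A B).trans (Matrix.rank_le_width A)

lemma exists_direction_eq {s : ℕ} (hs : 0 < s) (j : Fin s) (N : ℕ) :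
    ∃ n, N ≤ n ∧ direction hs n = j := by
  refine ⟨(s + 1) * (s * N + j), ?_, ?_⟩
  · nlinarith [Nat.zero_le (s * N), Nat.zero_le (j : ℕ), Nat.zero_le (s * (s * N + j))]
  · ext
    simp [direction, Nat.mod_eq_of_lt j.2]

lemma direction_add_eq_or {s : ℕ} (hs : 0 < s) (n : ℕ) {u : ℕ} (hu : u ≤ s) :
    direction hs (n + u) = direction hs n ∨
      direction hs (n + u) = direction hs (n + (s + 1)) := by
  have h1 : (n + (s + 1)) / (s + 1) = n / (s + 1) + 1 := Nat.add_div_right n (by omega)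
  have h2 : n / (s + 1) ≤ (n + u) / (s + 1) := Nat.div_le_div_right (by omega)
  have h3 : (n + u) / (s + 1) ≤ (n + (s + 1)) / (s + 1) := Nat.div_le_div_right (by omega)
  have h4 : (n + u) / (s + 1) = n / (s + 1) ∨ (n + u) / (s + 1) = (n + (s + 1)) / (s + 1) := by
    omega
  rcases h4 with h | h
  · exact Or.inl (Fin.ext (by simp [direction, h]))
  · exact Or.inr (Fin.ext (by simp only [direction, h]))

lemma IsBSASeq.rank_le_three {s : ℕ} (hs : 0 < s) {d : ℕ → ℤ} (hd : ∀ n, d n * d n = 1)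
    {α : Fin s → ℝ}
    (hα : ∀ n j, |(den n : ℝ) * α j - num (direction hs) d n j| ≤ 1 / (8 * den n))
    {ζ : ℕ → Fin (s + 1) → ℤ} (hζ : IsBSASeq α ζ) (ν : ℕ) :
    (Matrix.of fun i j : Fin (s + 1) => ζ (ν + (i : ℕ)) j).rank ≤ 3 := by
  obtain ⟨hbsa, hlt, hall⟩ := hζ
  have hmono : StrictMono fun ν => ζ ν 0 := strictMono_nat_of_lt_succ hlt
  obtain ⟨n, hn1, hn2⟩ : ∃ n, den n ≤ ζ ν 0 ∧ ζ ν 0 < den (n + 1) := by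
    have hex : ∃ n, ζ ν 0 < den n :=
      ⟨(ζ ν 0).toNat, (Int.self_le_toNat _).trans_lt (lt_den _)⟩
    have h1 := Nat.find_spec hex
    rcases hf : Nat.find hex with _ | n
    · rw [hf] at h1
      have h2 := (hbsa ν).1
      simp only [den] at h1
      omega
    · refine ⟨n, not_lt.1 (Nat.find_min hex (by omega)), ?_⟩
      rwa [hf] at h1
  have hupper : ∀ u, ζ (ν + u) 0 ≤ den (n + u + 1) := by
    intro u
    induction u with
    | zero => exact hn2.le
    | succ u ih =>
      obtain ⟨m, hm⟩ := hall _ (isBSA_vertex hd hα (n + u + 1 + 1))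
      have hm0 : ζ m 0 = den (n + u + 1 + 1) := by rw [hm]; simp [vertex]
      have h1 : ζ (ν + u) 0 < ζ m 0 := by
        rw [hm0]; exact ih.trans_lt (den_lt_succ _)
      have h2 : ν + u < m := hmono.lt_iff_lt.1 h1
      have h3 : ζ (ν + (u + 1)) 0 ≤ ζ m 0 := hmono.monotone (by omega)
      rw [hm0] at h3
      exact h3
  refine rank_le_three_of_forall_eq _ (den_pos n).ne' (num (direction hs) d n)
    (direction hs n) (direction hs (n + (s + 1))) fun a k hx hy => ?_
  refine (hbsa (ν + a)).eq_of_le_den_add (t := s) hd hα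
    (hn1.trans (hmono.monotone (by omega))) ?_ ?_
  · exact (hupper a).trans (den_strictMono.monotone (by omega))
  · intro u hu heq
    rcases direction_add_eq_or hs n hu with h | h
    · exact hx (heq.symm.trans h)
    · exact hy (heq.symm.trans h)

/-- For every `s ≥ 3` there is an uncountable set of `s`-tuples `α`,
each with `1, α₁, …, α_s` linearly independent over `ℚ`, such that for every `ν` the
matrix `M_ν[α]` of `s+1` consecutive b.s.a. has rank at most `3`; in particular its
determinant vanishes for all `ν`. -/
theorem stmt7 (s : ℕ) (hs : 3 ≤ s) :
    ∃ S : Set (Fin s → ℝ), ¬ S.Countable ∧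
      ∀ α ∈ S,
        (∀ c : Fin (s + 1) → ℤ,
          ((c 0 : ℝ) + ∑ j : Fin s, (c j.succ : ℝ) * α j = 0) → c = 0) ∧
        ∀ ζ : ℕ → Fin (s + 1) → ℤ, IsBSASeq α ζ → ∀ ν : ℕ,
          (Matrix.of fun i j : Fin (s + 1) => ζ (ν + (i : ℕ)) j).rank ≤ 3 ∧
          Matrix.det (Matrix.of fun i j : Fin (s + 1) => ζ (ν + (i : ℕ)) j) = 0 := by
  have hs0 : 0 < s := by omega
  let d : (ℕ → Bool) → ℕ → ℤ := fun e n => if e n then 1 else -1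
  have hd : ∀ e n, d e n * d e n = 1 := fun e n => by simp only [d]; split_ifs <;> norm_num
  choose α hα using fun e => exists_forall_abs_le (i := direction hs0) (hd e)
  have hinj : Function.Injective α := by
    intro e e' h
    have h1 : d e = d e' := eq_of_forall_abs_le (hα e) (h ▸ hα e')
    funext n
    have h2 := congrFun h1 n
    by_contra hne
    cases he : e n <;> cases he' : e' n <;> simp_all [d]
  refine ⟨Set.range α, fun hcount => ?_, ?_⟩
  · have : Countable (Set.range α) := hcount
    have h1 : Countable (ℕ → Bool) :=
      Function.Injective.countable (f := Set.rangeFactorization α)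
        fun e e' h => hinj (congrArg Subtype.val h)
    refine (Cardinal.mk_le_aleph0_iff.2 h1).not_gt ?_
    rw [← Cardinal.power_def, Cardinal.mk_bool, Cardinal.mk_nat]
    exact Cardinal.cantor Cardinal.aleph0
  · rintro _ ⟨e, rfl⟩
    refine ⟨eq_zero_of_add_sum_eq_zero (hd e) (exists_direction_eq hs0) (hα e),
      fun ζ hζ ν => ?_⟩
    have hrank := hζ.rank_le_three hs0 (hd e) (hα e) ν
    refine ⟨hrank, ?_⟩
    by_contra hdet
    rw [Matrix.rank_of_det_ne_zero hdet, Fintype.card_fin] at hrank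
    omega
end

section
/- Let f be a norm on ℝ^n and let α = (α₁,…,α_n) ∈ ℝ^n satisfy dim_ℤ(1, α₁, …, α_n) ≥ 3, with f-b.s.a. sequence τ_ν = (p_ν, a_ν) and remainder vectors ξ_ν = p_ν α − a_ν. Then f(ξ_ν) · p_{ν+1} → +∞ as ν → +∞. -/
open scoped BigOperators

/-- `f` is a (symmetric convex gauge) norm on `ℝ^n`. -/
structure IsGaugeNorm {n : ℕ} (f : (Fin n → ℝ) → ℝ) : Prop where
  continuous : Continuous f
  nonneg : ∀ x, 0 ≤ f x
  eq_zero_iff : ∀ x, f x = 0 ↔ x = 0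
  neg : ∀ x, f (-x) = f x
  smul : ∀ t : ℝ, 0 ≤ t → ∀ x, f (t • x) = t * f x
  add_le : ∀ x y, f (x + y) ≤ f x + f y

/-- The remainder vector `ξ = p·α − a`. -/
noncomputable def xiv {n : ℕ} (α : Fin n → ℝ) (p : ℤ) (a : Fin n → ℤ) : Fin n → ℝ :=
  fun j => (p : ℝ) * α j - (a j : ℝ)

/-- `(p, a)` with `p ≥ 1` is an `f`-best simultaneous approximation to `α`. -/
def IsFBSA {n : ℕ} (f : (Fin n → ℝ) → ℝ) (α : Fin n → ℝ) (p : ℤ) (a : Fin n → ℤ) : Prop :=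
  1 ≤ p ∧
  (∀ (q : ℤ) (b : Fin n → ℤ), 1 ≤ q → q ≤ p - 1 → f (xiv α p a) < f (xiv α q b)) ∧
  (∀ b : Fin n → ℤ, b ≠ a → f (xiv α p a) < f (xiv α p b))

/-- `τ : ℕ → ℤ × ℤ^n` is the (exhaustive) sequence of all `f`-b.s.a. to `α`,
with strictly increasing `p_ν`. -/
def IsFBSASeq {n : ℕ} (f : (Fin n → ℝ) → ℝ) (α : Fin n → ℝ)
    (τ : ℕ → ℤ × (Fin n → ℤ)) : Prop :=
  (∀ ν : ℕ, IsFBSA f α (τ ν).1 (τ ν).2) ∧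
  (∀ ν : ℕ, (τ ν).1 < (τ (ν + 1)).1) ∧
  (∀ (p : ℤ) (a : Fin n → ℤ), IsFBSA f α p a → ∃ ν : ℕ, τ ν = (p, a))

/-- The normalized remainder `Ξ_ν = ξ_ν / f(ξ_ν)`. -/
noncomputable def Xiv {n : ℕ} (f : (Fin n → ℝ) → ℝ) (α : Fin n → ℝ)
    (τ : ℕ → ℤ × (Fin n → ℤ)) (ν : ℕ) : Fin n → ℝ :=
  (f (xiv α (τ ν).1 (τ ν).2))⁻¹ • xiv α (τ ν).1 (τ ν).2

/-- `f` is strictly convex: the boundary of its unit ball contains no line segment. -/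
def StrictlyConvexNorm {n : ℕ} (f : (Fin n → ℝ) → ℝ) : Prop :=
  ∀ x y : Fin n → ℝ, f x = 1 → f y = 1 → x ≠ y →
    ∀ t : ℝ, t ∈ Set.Ioo (0 : ℝ) 1 → f (t • x + (1 - t) • y) < 1

open Filter

/-- A gauge norm on `ℝ^n` dominates a positive multiple of the sup norm. -/
lemma IsGaugeNorm.exists_pos_mul_norm_le {n : ℕ} {f : (Fin n → ℝ) → ℝ} (hf : IsGaugeNorm f) :
    ∃ c : ℝ, 0 < c ∧ ∀ x, c * ‖x‖ ≤ f x := by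
  by_cases hne : (Metric.sphere (0 : Fin n → ℝ) 1).Nonempty
  · obtain ⟨y, hy, hmin⟩ := (isCompact_sphere (0 : Fin n → ℝ) 1).exists_isMinOn hne
      hf.continuous.continuousOn
    have hy0 : y ≠ 0 := by
      rintro rfl
      simp at hy
    refine ⟨f y, lt_of_le_of_ne (hf.nonneg y) fun h => hy0 ((hf.eq_zero_iff y).1 h.symm), ?_⟩
    intro x
    rcases eq_or_ne x 0 with rfl | hx
    · simpa using hf.nonneg 0
    have hx' : 0 < ‖x‖ := norm_pos_iff.2 hx
    have hmem : ‖x‖⁻¹ • x ∈ Metric.sphere (0 : Fin n → ℝ) 1 := by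
      simp [norm_smul, hx'.ne']
    have h : f y ≤ f (‖x‖⁻¹ • x) := hmin hmem
    rw [hf.smul _ (inv_nonneg.2 hx'.le)] at h
    calc f y * ‖x‖ ≤ (‖x‖⁻¹ * f x) * ‖x‖ := by gcongr
      _ = f x := by field_simp
  · refine ⟨1, one_pos, fun x => ?_⟩
    have hx : x = 0 := by
      by_contra hx
      refine hne ⟨‖x‖⁻¹ • x, ?_⟩
      simp [norm_smul, norm_ne_zero_iff.2 hx]
    simpa [hx] using hf.nonneg 0

/-- Only finitely many integer points lie in a given ball of a gauge norm. -/
lemma IsGaugeNorm.finite_setOf_intCast_le {n : ℕ} {f : (Fin n → ℝ) → ℝ} (hf : IsGaugeNorm f)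
    (R : ℝ) : {w : Fin n → ℤ | f (fun j => (w j : ℝ)) ≤ R}.Finite := by
  obtain ⟨c, hc, h⟩ := hf.exists_pos_mul_norm_le
  refine (Set.finite_Icc (fun _ => -⌈R / c⌉ : Fin n → ℤ) (fun _ => ⌈R / c⌉)).subset ?_
  intro w hw
  have key : ∀ j, |w j| ≤ ⌈R / c⌉ := by
    intro j
    have h1 : |(w j : ℝ)| ≤ ‖fun j => (w j : ℝ)‖ := norm_le_pi_norm (fun j => (w j : ℝ)) j
    have h2 : ‖fun j => (w j : ℝ)‖ ≤ R / c := by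
      rw [le_div_iff₀ hc, mul_comm]
      exact (h _).trans hw
    have h3 : ((|w j| : ℤ) : ℝ) ≤ (⌈R / c⌉ : ℤ) := by
      push_cast
      exact (h1.trans h2).trans (Int.le_ceil _)
    exact_mod_cast h3
  exact ⟨fun j => (abs_le.1 (key j)).1, fun j => (abs_le.1 (key j)).2⟩

/-- If every `2 × 2` minor of `(α, w)` is an integer and `w ≠ 0` is integral, then `1` and the
coordinates of `α` span a space of dimension at most two over `ℚ`. -/
lemma finrank_span_insert_one_range_le_two {n : ℕ} {α : Fin n → ℝ} {w : Fin n → ℤ} (hw : w ≠ 0)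
    (h : ∀ i j, ∃ m : ℤ, α i * w j - α j * w i = m) :
    Module.finrank ℚ ↥(Submodule.span ℚ (insert (1 : ℝ) (Set.range α))) ≤ 2 := by
  classical
  obtain ⟨i, hi⟩ := Function.ne_iff.1 hw
  have hi' : (w i : ℝ) ≠ 0 := by exact_mod_cast hi
  have hle : Submodule.span ℚ (insert (1 : ℝ) (Set.range α)) ≤
      Submodule.span ℚ (({1, α i} : Finset ℝ) : Set ℝ) := by
    rw [Submodule.span_le]
    rintro x (rfl | ⟨j, rfl⟩)
    · exact Submodule.subset_span (by simp)
    · obtain ⟨m, hm⟩ := h i j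
      have hj : α j = (-(m : ℚ) / w i) • (1 : ℝ) + ((w j : ℚ) / w i) • α i := by
        simp only [Rat.smul_def]
        push_cast
        field_simp
        linarith
      rw [hj]
      exact add_mem (Submodule.smul_mem _ _ (Submodule.subset_span (by simp)))
        (Submodule.smul_mem _ _ (Submodule.subset_span (by simp)))
  exact (Submodule.finrank_mono hle).trans
    ((finrank_span_finset_le_card _).trans Finset.card_le_two)

/-- A real number that is approximated arbitrarily well by integers is an integer. -/
lemma exists_eq_intCast_of_forall_abs_sub_lt {x : ℝ} (h : ∀ ε > 0, ∃ m : ℤ, |x - m| < ε) :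
    ∃ m : ℤ, x = m := by
  refine ⟨round x, ?_⟩
  by_contra hx
  obtain ⟨m, hm⟩ := h _ (abs_pos.2 (sub_ne_zero.2 hx))
  exact absurd (round_le x m) (not_le.2 hm)

/-- If `dim_ℤ(1, α₁, …, α_n) ≥ 3` then `f(ξ_ν) · p_{ν+1} → +∞`. -/
theorem stmt9 (n : ℕ) (f : (Fin n → ℝ) → ℝ) (hf : IsGaugeNorm f)
    (α : Fin n → ℝ)
    (hα : 3 ≤ Module.finrank ℚ ↥(Submodule.span ℚ (insert (1 : ℝ) (Set.range α))))
    (τ : ℕ → ℤ × (Fin n → ℤ)) (hτ : IsFBSASeq f α τ) :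
    Filter.Tendsto (fun ν : ℕ => f (xiv α (τ ν).1 (τ ν).2) * ((τ (ν + 1)).1 : ℝ))
      Filter.atTop Filter.atTop := by
  obtain ⟨hbest, hlt, -⟩ := hτ
  have hp1 : ∀ ν, (1 : ℝ) ≤ (τ ν).1 := fun ν => by exact_mod_cast (hbest ν).1
  have hplt : ∀ ν, ((τ ν).1 : ℝ) < (τ (ν + 1)).1 := fun ν => by exact_mod_cast hlt ν
  have hpinf : Tendsto (fun ν => ((τ ν).1 : ℝ)) atTop atTop := by
    refine tendsto_atTop_mono (f := fun ν : ℕ => (ν : ℝ)) (fun ν => ?_) tendsto_natCast_atTop_atTop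
    induction ν with
    | zero => simpa using zero_le_one.trans (hp1 0)
    | succ k ih =>
      have h1 : (τ k).1 + 1 ≤ (τ (k + 1)).1 := hlt k
      have h2 : ((τ k).1 : ℝ) + 1 ≤ (τ (k + 1)).1 := by exact_mod_cast h1
      push_cast
      linarith
  set ξ : ℕ → Fin n → ℝ := fun ν => xiv α (τ ν).1 (τ ν).2 with hξ
  have hdec : ∀ ν, f (ξ (ν + 1)) < f (ξ ν) := fun ν =>
    (hbest (ν + 1)).2.1 _ _ (hbest ν).1 (by have := hlt ν; omega)
  let W : ℕ → Fin n → ℤ := fun ν j => (τ ν).1 * (τ (ν + 1)).2 j - (τ (ν + 1)).1 * (τ ν).2 j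
  have hW : ∀ ν, (fun j => (W ν j : ℝ)) =
      ((τ (ν + 1)).1 : ℝ) • ξ ν + -(((τ ν).1 : ℝ) • ξ (ν + 1)) := by
    intro ν
    ext j
    simp only [W, hξ, xiv, Pi.add_apply, Pi.neg_apply, Pi.smul_apply, smul_eq_mul]
    push_cast
    ring
  have hWne : ∀ ν, W ν ≠ 0 := by
    intro ν h0
    have h1 := hW ν
    have h2 : (fun j => (W ν j : ℝ)) = 0 := by
      ext j
      simp [h0]
    rw [h2, eq_comm, add_neg_eq_zero] at h1
    have h3 := congrArg f h1
    rw [hf.smul _ (by linarith [hp1 (ν + 1)]), hf.smul _ (by linarith [hp1 ν])] at h3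
    nlinarith [hp1 ν, hplt ν, hdec ν, hf.nonneg (ξ (ν + 1))]
  by_contra hcon
  rw [tendsto_atTop] at hcon
  push Not at hcon
  obtain ⟨C, hC⟩ := hcon
  have hCle : ∀ ν, f (ξ ν) * (τ (ν + 1)).1 < C → f (fun j => (W ν j : ℝ)) ≤ 2 * C := by
    intro ν h
    rw [hW]
    refine (hf.add_le _ _).trans ?_
    rw [hf.neg, hf.smul _ (by linarith [hp1 (ν + 1)]), hf.smul _ (by linarith [hp1 ν])]
    nlinarith [hp1 ν, hplt ν, hdec ν, hf.nonneg (ξ (ν + 1))]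
  obtain ⟨w, hw⟩ : ∃ w : Fin n → ℤ, ∃ᶠ ν in atTop,
      f (ξ ν) * (τ (ν + 1)).1 < C ∧ W ν = w := by
    by_contra hno
    push Not at hno
    have hev := (eventually_all_finite (hf.finite_setOf_intCast_le (2 * C))).2
      fun w _ => hno w
    obtain ⟨ν, h1, h2⟩ := (hC.and_eventually hev).exists
    exact h2 (W ν) (hCle ν h1) h1 rfl
  obtain ⟨ν₀, -, hν₀⟩ := hw.exists
  have hw0 : w ≠ 0 := hν₀ ▸ hWne ν₀
  obtain ⟨c, hc, hcf⟩ := hf.exists_pos_mul_norm_le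
  refine absurd (finrank_span_insert_one_range_le_two (α := α) hw0 fun i j => ?_) (by omega)
  refine exists_eq_intCast_of_forall_abs_sub_lt fun ε hε => ?_
  set B : ℝ := C / c * (|(w j : ℝ)| + |(w i : ℝ)|)
  obtain ⟨ν, ⟨h1, h2⟩, h3⟩ :=
    (hw.and_eventually (hpinf.eventually_gt_atTop (B / ε))).exists
  have hp := hp1 ν
  have hfC : f (ξ ν) ≤ C := by nlinarith [hp1 (ν + 1), hf.nonneg (ξ ν)]
  have hcoord : ∀ k, |ξ ν k| ≤ C / c := by
    intro k
    rw [le_div_iff₀ hc, mul_comm]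
    refine le_trans ?_ ((hcf (ξ ν)).trans hfC)
    gcongr
    exact norm_le_pi_norm (ξ ν) k
  refine ⟨(τ ν).2 i * (τ (ν + 1)).2 j - (τ ν).2 j * (τ (ν + 1)).2 i, ?_⟩
  have hid : (τ ν).1 * (α i * w j - α j * w i -
      (((τ ν).2 i * (τ (ν + 1)).2 j - (τ ν).2 j * (τ (ν + 1)).2 i : ℤ) : ℝ)) =
      ξ ν i * w j - ξ ν j * w i := by
    rw [← h2]
    simp only [W, hξ, xiv]
    push_cast
    ring
  have hbound : |ξ ν i * w j - ξ ν j * w i| ≤ B := by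
    refine (abs_sub _ _).trans ?_
    rw [abs_mul, abs_mul]
    have e1 := mul_le_mul_of_nonneg_right (hcoord i) (abs_nonneg (w j : ℝ))
    have e2 := mul_le_mul_of_nonneg_right (hcoord j) (abs_nonneg (w i : ℝ))
    calc _ ≤ _ := add_le_add e1 e2
      _ = B := by ring
  rw [← hid, abs_mul, abs_of_pos (by linarith)] at hbound
  rw [div_lt_iff₀ hε] at h3
  exact lt_of_mul_lt_mul_left (hbound.trans_lt h3) (by linarith)
end
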